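/- arXiv:math/0603618 — 3 statements merged into one kernel-verified Lean document; each statement's English description precedes it below -/
import Mathlib

section
/- For every integer r with 1 ≤ r ≤ n the following two estimates hold: (a) for all integers a_1, …, a_r with j ≤ a_j ≤ n for each j, one has (q−1)·λ_{a_1} + (q^2−q)·λ_{a_2} + ⋯ + (q^r − q^{r−1})·λ_{a_r} ≤ r/n; (b) (q−1)·λ_{n−r+1} + (q^2−q)·λ_{n−r+2} + ⋯ + (q^r − q^{r−1})·λ_n ≥ r/(n·q^{n−r}). (These are the two key numerical estimates in the proof of Proposition 3.5, which determines exactly when two points of the Gross–Hopkins fundamental domain carry isogenous formal groups.) -/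
theorem Finset.sum_Icc_one_add {M : Type*} [AddCommMonoid M] (f : ℕ → M) (k r : ℕ) :
    ∑ i ∈ Finset.Icc 1 (k + r), f i =
      ∑ i ∈ Finset.Icc 1 k, f i + ∑ j ∈ Finset.Icc 1 r, f (k + j) := by
  induction r with
  | zero => simp
  | succ r ih =>
    rw [← add_assoc, Finset.sum_Icc_succ_top (by omega), Finset.sum_Icc_succ_top (by omega), ih,
      add_assoc, add_assoc]

/-- Fix integers `q ≥ 2` and `n ≥ 1`, and real numbers
`λ 1 ≥ λ 2 ≥ ⋯ ≥ λ n ≥ 0` satisfying `Σ_{i=1}^{n} (q^i − q^{i−1})·λ i = 1` and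
`Σ_{i=1}^{m} (q^i − q^{i−1})·λ i ≤ m/n` for every `1 ≤ m ≤ n`.  Then for every `1 ≤ r ≤ n`:
(a) for all integers `a 1, …, a r` with `j ≤ a j ≤ n` for each `j`, one has
`Σ_{j=1}^{r} (q^j − q^{j−1})·λ (a j) ≤ r/n`;
(b) `Σ_{j=1}^{r} (q^j − q^{j−1})·λ (n−r+j) ≥ r/(n·q^{n−r})`. -/
theorem gross_hopkins_slope_estimates (q n : ℕ) (hq : 2 ≤ q) (hn : 1 ≤ n) (lam : ℕ → ℝ)
    (hantitone : ∀ i j, 1 ≤ i → i ≤ j → j ≤ n → lam j ≤ lam i)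
    (hnonneg : ∀ i, 1 ≤ i → i ≤ n → 0 ≤ lam i)
    (hsum : ∑ i ∈ Finset.Icc 1 n, ((q : ℝ) ^ i - (q : ℝ) ^ (i - 1)) * lam i = 1)
    (hpartial : ∀ m, 1 ≤ m → m ≤ n →
      ∑ i ∈ Finset.Icc 1 m, ((q : ℝ) ^ i - (q : ℝ) ^ (i - 1)) * lam i ≤ (m : ℝ) / n) :
    ∀ r, 1 ≤ r → r ≤ n →
      (∀ a : ℕ → ℕ, (∀ j, 1 ≤ j → j ≤ r → j ≤ a j ∧ a j ≤ n) →
        ∑ j ∈ Finset.Icc 1 r, ((q : ℝ) ^ j - (q : ℝ) ^ (j - 1)) * lam (a j) ≤ (r : ℝ) / n) ∧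
      (r : ℝ) / (n * (q : ℝ) ^ (n - r)) ≤
        ∑ j ∈ Finset.Icc 1 r, ((q : ℝ) ^ j - (q : ℝ) ^ (j - 1)) * lam (n - r + j) := by
  intro r hr hrn
  have hq1 : (1 : ℝ) ≤ q := by exact_mod_cast (by omega : 1 ≤ q)
  refine ⟨fun a ha => (Finset.sum_le_sum fun j hj => ?_).trans (hpartial r hr hrn), ?_⟩
  · rw [Finset.mem_Icc] at hj
    obtain ⟨hja, han⟩ := ha j hj.1 hj.2
    exact mul_le_mul_of_nonneg_left (hantitone j (a j) hj.1 hja han)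
      (sub_nonneg.2 (pow_le_pow_right₀ hq1 (Nat.sub_le j 1)))
  · obtain ⟨k, rfl⟩ := Nat.exists_eq_add_of_le' hrn
    rw [Nat.add_sub_cancel]
    have hhead : ∑ i ∈ Finset.Icc 1 k, ((q : ℝ) ^ i - (q : ℝ) ^ (i - 1)) * lam i ≤
        (k : ℝ) / (k + r : ℕ) := by
      rcases Nat.eq_zero_or_pos k with rfl | hk
      · simp
      · exact hpartial k hk (Nat.le_add_right k r)
    have htail : ∑ j ∈ Finset.Icc 1 r,
          ((q : ℝ) ^ (k + j) - (q : ℝ) ^ (k + j - 1)) * lam (k + j) =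
        (q : ℝ) ^ k * ∑ j ∈ Finset.Icc 1 r, ((q : ℝ) ^ j - (q : ℝ) ^ (j - 1)) * lam (k + j) := by
      rw [Finset.mul_sum]
      refine Finset.sum_congr rfl fun j hj => ?_
      rw [Nat.add_sub_assoc (Finset.mem_Icc.1 hj).1, pow_add, pow_add]
      ring
    rw [Finset.sum_Icc_one_add, htail] at hsum
    have hn0 : ((k + r : ℕ) : ℝ) ≠ 0 := by exact_mod_cast (by omega : k + r ≠ 0)
    have hsplit : (k : ℝ) / (k + r : ℕ) + (r : ℝ) / (k + r : ℕ) = 1 := by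
      rw [← add_div, ← Nat.cast_add, div_self hn0]
    rw [← div_div, div_le_iff₀' (by positivity)]
    linarith
end

section
/- Let E be a finite free W-module equipped with: an additive map φ : E → E satisfying φ(c·x) = σ(c)·φ(x) for all c ∈ W and x ∈ E; an additive map V : E → E satisfying V(c·x) = σ^{−1}(c)·V(x) for all c ∈ W and x ∈ E; a ring homomorphism ι : O → End_W(E) such that φ(ι(a)(x)) = ι(a)(φ(x)) and V(ι(a)(x)) = ι(a)(V(x)) for all a ∈ O and x ∈ E; and a natural number m with φ∘V = V∘φ = p^m·id_E. Then E, with the O ⊗_{ℤ_p} W-module structure determined by ι and the W-action, is a free O ⊗_{ℤ_p} W-module. (This is the Dieudonné-module incarnation of Lemma B.1: an F-crystal equipped with an action of O is locally free over O_{S/Σ} ⊗_{ℤ_p} O.) -/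
noncomputable section

open scoped TensorProduct

variable (p : ℕ) [Fact p.Prime]
variable (k : Type*) [Field k] [IsAlgClosed k] [CharP k p]

/-- The `ℤ_p`-algebra structure on `W = 𝕎(k)`, via `ℤ_p ≃ 𝕎(𝔽_p) → 𝕎(k)`. -/
instance wittZpAlgebra : Algebra ℤ_[p] (WittVector p k) :=
  ((WittVector.map (ZMod.castHom (dvd_refl p) k)).comp
    (WittVector.equiv p).symm.toRingHom).toAlgebra

variable (E : Type*) [AddCommGroup E] [Module (WittVector p k) E]
variable (F : Type*) [Field F] [Algebra ℚ_[p] F] [FiniteDimensional ℚ_[p] F]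
  [Algebra ℤ_[p] F] [IsScalarTower ℤ_[p] ℚ_[p] F]

/-- The `O ⊗_{ℤ_p} W`-module structure on `E` determined by `ι` and the `W`-action:
`(a ⊗ c) • x = ι(a)(c • x)`, where `O = O_F` is the ring of integers of `F` (the integral
closure of `ℤ_p` in `F`).  The compatibility hypothesis `hι` over `ℤ_p` is exactly what is
needed for this action to be well defined on the tensor product over `ℤ_p`. -/
def dieudonneTensorModule
    (ι : (integralClosure ℤ_[p] F) →+* Module.End (WittVector p k) E)
    (hι : ∀ z : ℤ_[p], ι (algebraMap ℤ_[p] (integralClosure ℤ_[p] F) z) =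
      algebraMap ℤ_[p] (WittVector p k) z • (1 : Module.End (WittVector p k) E)) :
    Module ((integralClosure ℤ_[p] F) ⊗[ℤ_[p]] (WittVector p k)) E :=
  letI : Module ℤ_[p] E := Module.compHom E (algebraMap ℤ_[p] (WittVector p k))
  haveI : IsScalarTower ℤ_[p] (WittVector p k) E :=
    ⟨fun z c x => by
      show (algebraMap ℤ_[p] (WittVector p k) z * c) • x =
        algebraMap ℤ_[p] (WittVector p k) z • (c • x)
      rw [mul_smul]⟩
  haveI : SMulCommClass (WittVector p k) ℤ_[p] E :=
    ⟨fun c z x => by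
      show c • (algebraMap ℤ_[p] (WittVector p k) z • x) =
        algebraMap ℤ_[p] (WittVector p k) z • (c • x)
      rw [smul_comm]⟩
  Module.compHom E
    (Algebra.TensorProduct.lift
      { toRingHom := ι,
        commutes' := fun z => by
          show ι (algebraMap ℤ_[p] (integralClosure ℤ_[p] F) z) =
            algebraMap ℤ_[p] (Module.End (WittVector p k) E) z
          rw [hι z, Module.algebraMap_end_eq_smul_id]
          exact LinearMap.ext fun x => rfl }
      (Algebra.lsmul ℤ_[p] (WittVector p k) E)
      (fun a c => LinearMap.ext fun x => ((ι a).map_smul c x))).toRingHom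

section Helpers

theorem IsPrecomplete.of_moduleFinite {R M : Type*} [CommRing R] [AddCommGroup M] [Module R M]
    [Module.Finite R M] (I : Ideal R) [IsPrecomplete I R] : IsPrecomplete I M := by
  rw [← AdicCompletion.of_surjective_iff]
  intro y
  obtain ⟨t, rfl⟩ := AdicCompletion.ofTensorProduct_surjective_of_finite I M y
  induction t with
  | zero => exact ⟨0, by simp⟩
  | tmul r x =>
    obtain ⟨r, rfl⟩ := AdicCompletion.of_surjective I R r
    refine ⟨r • x, ?_⟩
    rw [AdicCompletion.ofTensorProduct_tmul, map_smul]
    ext n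
    rfl
  | add a b ha hb =>
    obtain ⟨u, hu⟩ := ha
    obtain ⟨v, hv⟩ := hb
    exact ⟨u + v, by rw [map_add, map_add, hu, hv]⟩

theorem IsAdicComplete.map_of_finite {R A : Type*} [CommRing R] [IsNoetherianRing R] [CommRing A]
    [Algebra R A] [Module.Finite R A] (I : Ideal R) [IsAdicComplete I R] :
    IsAdicComplete (I.map (algebraMap R A)) A where
  toIsHausdorff := (IsHausdorff.map_algebraMap_iff (M := A)).2
    (IsHausdorff.of_le_jacobson I A (IsAdicComplete.le_jacobson_bot I))
  toIsPrecomplete := (IsPrecomplete.map_algebraMap_iff (M := A)).2 (.of_moduleFinite I)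

theorem IsAdicComplete.of_pow_le {A : Type*} [CommRing A] {I J : Ideal A} [IsAdicComplete I A]
    (hIJ : I ≤ J) {n : ℕ} (hn : J ^ n ≤ I) (hn0 : n ≠ 0) : IsAdicComplete J A where
  haus' x hx := by
    refine IsHausdorff.haus (I := I) inferInstance x fun i => ?_
    have := hx (n * i)
    rw [SModEq.zero] at this ⊢
    simp only [smul_eq_mul, Ideal.mul_top] at this ⊢
    rw [pow_mul] at this
    exact Ideal.pow_right_mono hn i this
  prec' f hf := by
    simp only [smul_eq_mul, Ideal.mul_top, SModEq.sub_mem] at hf ⊢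
    obtain ⟨L, hL⟩ := IsPrecomplete.prec (I := I) inferInstance (f := fun i => f (n * i))
      (fun {a b} hab => by
        simp only [smul_eq_mul, Ideal.mul_top, SModEq.sub_mem]
        have := hf (Nat.mul_le_mul_left n hab)
        rw [pow_mul] at this
        exact Ideal.pow_right_mono hn a this)
    refine ⟨L, fun i => ?_⟩
    have h1 := hL i
    simp only [smul_eq_mul, Ideal.mul_top, SModEq.sub_mem] at h1
    have h2 := hf (Nat.le_mul_of_pos_left i (Nat.pos_of_ne_zero hn0))
    have := add_mem h2 (Ideal.pow_right_mono hIJ i h1)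
    simpa using this

theorem exists_pow_mem_of_not_isUnit {A : Type*} [CommRing A] [IsDomain A]
    (I : Ideal A) [HenselianRing A I] [Finite (A ⧸ I)] {x : A} (hx : ¬ IsUnit x) :
    ∃ n, x ^ n ∈ I := by
  obtain ⟨m, k, hk, h⟩ : ∃ m k : ℕ, 0 < k ∧
      Ideal.Quotient.mk I x ^ (m + k) = Ideal.Quotient.mk I x ^ m := by
    obtain ⟨a, b, hab, h⟩ := Finite.exists_ne_map_eq_of_infinite
      (fun n : ℕ => Ideal.Quotient.mk I x ^ n)
    rcases lt_or_gt_of_ne hab with hlt | hlt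
    · exact ⟨a, b - a, by omega, by rw [Nat.add_sub_cancel' hlt.le]; exact h.symm⟩
    · exact ⟨b, a - b, by omega, by rw [Nat.add_sub_cancel' hlt.le]; exact h⟩
  set y := Ideal.Quotient.mk I x with hy
  have h1 (j : ℕ) : y ^ (m + k * j) = y ^ m := by
    induction j with
    | zero => simp
    | succ j ih => rw [Nat.mul_succ, ← add_assoc, pow_add, ih, ← pow_add, h]
  have h2 (j i : ℕ) (hi : m ≤ i) : y ^ (i + k * j) = y ^ i := by
    obtain ⟨c, rfl⟩ := Nat.exists_eq_add_of_le hi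
    rw [add_right_comm, pow_add, h1, ← pow_add]
  set N := k * (m + 1) with hN
  have hmN : m ≤ N := by nlinarith
  have hidem : y ^ N * y ^ N = y ^ N := by
    rw [← pow_add]; exact h2 _ _ hmN
  obtain ⟨a, ha, hax⟩ := HenselianRing.is_henselian (I := I) (Polynomial.X ^ 2 - Polynomial.X)
    (Polynomial.monic_X_pow_sub (by simp)) (x ^ N)
    (by
      rw [← Ideal.Quotient.eq_zero_iff_mem]
      simp [← hy, pow_two, hidem])
    (by
      refine IsUnit.of_mul_eq_one (2 * y ^ N - 1) ?_
      simp only [Polynomial.derivative_X_pow, Polynomial.derivative_X,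
        Polynomial.eval_sub, Polynomial.eval_mul, Polynomial.eval_pow, Polynomial.eval_X,
        Polynomial.eval_C, Polynomial.eval_one, map_sub, map_mul, map_pow, map_one, ← hy]
      push_cast
      simp only [map_ofNat]
      linear_combination 4 * hidem)
  have ha' : a * (a - 1) = 0 := by
    have : a ^ 2 - a = 0 := by simpa [Polynomial.IsRoot] using ha
    linear_combination this
  rcases mul_eq_zero.1 ha' with h0 | h0
  · exact ⟨N, by simpa [h0] using hax⟩
  · exfalso
    apply hx
    have hj := HenselianRing.jac (I := I) hax
    rw [sub_eq_zero.1 h0, Ideal.mem_jacobson_bot] at hj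
    have := hj (-1)
    have hu : IsUnit (x ^ N) := by convert this using 1; ring
    exact (isUnit_pow_iff (by positivity)).1 hu

/-- A domain that is Henselian along an ideal with finite quotient is local. -/
theorem IsLocalRing.of_henselianRing_of_finite_quotient {A : Type*} [CommRing A] [IsDomain A]
    (I : Ideal A) [HenselianRing A I] [Finite (A ⧸ I)] : IsLocalRing A := by
  have hI : I ≠ ⊤ := fun h => by
    have := HenselianRing.jac (R := A) (I := I)
    rw [h, top_le_iff, Ideal.jacobson_eq_top_iff] at this
    exact bot_ne_top this
  refine IsLocalRing.of_nonunits_add fun a b ha hb hab => hI ?_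
  rw [← Ideal.radical_eq_top]
  exact Ideal.eq_top_of_isUnit_mem _
    (add_mem (exists_pow_mem_of_not_isUnit I ha) (exists_pow_mem_of_not_isUnit I hb)) hab
open IsLocalRing

theorem Module.length_quotient_maximalIdeal_smul_top (B M : Type*) [CommRing B] [IsLocalRing B]
    [AddCommGroup M] [Module B M] [Module.Finite B M] [Module.Free B M] :
    Module.length B (M ⧸ (maximalIdeal B • ⊤ : Submodule B M)) = Module.finrank B M := by
  let := Ideal.Quotient.field (maximalIdeal B)
  have h1 : Module.length B (M ⧸ (maximalIdeal B • ⊤ : Submodule B M)) =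
    Module.length (B ⧸ maximalIdeal B) (M ⧸ (maximalIdeal B • ⊤ : Submodule B M)) :=
      Module.length_eq_of_surjective Ideal.Quotient.mk_surjective
  have : Module.Finite (B ⧸ maximalIdeal B) (M ⧸ (maximalIdeal B • ⊤ : Submodule B M)) :=
    Module.Finite.of_restrictScalars_finite B _ _
  let e := (TensorProduct.quotTensorEquivQuotSMul M (maximalIdeal B)).extendScalarsOfSurjective
    (S := B ⧸ maximalIdeal B) Ideal.Quotient.mk_surjective
  rw [h1, Module.length_eq_finrank, ← e.finrank_eq, Module.finrank_baseChange]

theorem Module.length_quotient_range_pow {B M : Type*} [CommRing B] [AddCommGroup M] [Module B M]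
    (T : Module.End B M) (hT : Function.Injective T) (e : ℕ) :
    Module.length B (M ⧸ LinearMap.range (T ^ e)) =
      e * Module.length B (M ⧸ LinearMap.range T) := by
  induction e with
  | zero => 
    have : LinearMap.range (T ^ 0) = ⊤ := by simp [Module.End.one_eq_id]
    rw [this]
    simp [Module.length_eq_zero]
  | succ e ih =>
    have hT' : Function.Injective (T ^ e : Module.End B M) := by
      rw [Module.End.coe_pow]; exact hT.iterate e
    have hle : LinearMap.range (T ^ (e + 1)) ≤ LinearMap.range (T ^ e) := by
      rw [pow_succ]; exact LinearMap.range_comp_le_range _ _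
    have hcomap : LinearMap.range T ≤ (LinearMap.range (T ^ (e + 1))).comap (T ^ e) := by
      rintro _ ⟨x, rfl⟩
      exact ⟨x, by rw [pow_succ]; rfl⟩
    rw [Module.length_eq_add_of_exact (Submodule.mapQ _ _ (T ^ e) hcomap)
      (Submodule.factor hle) ?_ (Submodule.factor_surjective hle) ?_, ih]
    · push_cast; ring
    · rw [← LinearMap.ker_eq_bot, eq_bot_iff]
      intro x hx
      obtain ⟨x, rfl⟩ := Submodule.Quotient.mk_surjective _ x
      rw [LinearMap.mem_ker, Submodule.mapQ_apply, Submodule.Quotient.mk_eq_zero] at hx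
      obtain ⟨y, hy⟩ := hx
      rw [pow_succ] at hy
      rw [Submodule.mem_bot, Submodule.Quotient.mk_eq_zero]
      exact ⟨y, hT' hy⟩
    · intro x
      obtain ⟨x, rfl⟩ := Submodule.Quotient.mk_surjective _ x
      rw [← Submodule.mkQ_apply, Submodule.factor_mk, Submodule.mkQ_apply,
        Submodule.Quotient.mk_eq_zero]
      constructor
      · rintro ⟨y, rfl⟩
        exact ⟨Submodule.Quotient.mk y, rfl⟩
      · rintro ⟨y, hy⟩
        obtain ⟨y, rfl⟩ := Submodule.Quotient.mk_surjective _ y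
        rw [Submodule.mapQ_apply, Submodule.mkQ_apply, Submodule.Quotient.eq] at hy
        have := (LinearMap.range (T ^ e)).sub_mem ⟨y, rfl⟩ (hle hy)
        simpa using this

theorem Module.exists_span_range_eq_top_of_length {B Q : Type*} [CommRing B] [IsLocalRing B]
    [AddCommGroup Q] [Module B Q] [Module.Finite B Q]
    (hQ : Module.IsTorsionBySet B Q (maximalIdeal B)) :
    ∃ n : ℕ, Module.length B Q = n ∧ ∃ x : Fin n → Q, Submodule.span B (Set.range x) = ⊤ := by
  let := Ideal.Quotient.field (maximalIdeal B)
  let := hQ.module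
  have h1 : Module.length B Q = Module.length (B ⧸ maximalIdeal B) Q :=
      Module.length_eq_of_surjective Ideal.Quotient.mk_surjective
  have : Module.Finite (B ⧸ maximalIdeal B) Q :=
    Module.Finite.of_restrictScalars_finite B _ _
  refine ⟨_, h1.trans (Module.length_eq_finrank _ _), Module.finBasis (B ⧸ maximalIdeal B) Q, ?_⟩
  rw [← Submodule.restrictScalars_span B (B ⧸ maximalIdeal B) Ideal.Quotient.mk_surjective,
    Module.Basis.span_eq, Submodule.restrictScalars_top]

/-- An injective endomorphism `T` with `T ^ e` generating the maximal ideal up to units divides the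
rank by `e`: the quotient `rank / e` is the number of generators of the cokernel of `T`. -/
theorem Module.End.exists_generators_mod_range {B M : Type*} [CommRing B] [IsLocalRing B]
    [AddCommGroup M] [Module B M] [Module.Finite B M] [Module.Free B M]
    (T : Module.End B M) (hT : Function.Injective T) {e : ℕ} (he : e ≠ 0)
    (hTe : LinearMap.range (T ^ e) = maximalIdeal B • ⊤) :
    ∃ n : ℕ, Module.length B (M ⧸ LinearMap.range T) = n ∧ Module.finrank B M = e * n ∧
      ∃ x : Fin n → M, Submodule.span B (Set.range x) ⊔ LinearMap.range T = ⊤ := by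
  have hle : LinearMap.range (T ^ e) ≤ LinearMap.range T := by
    obtain ⟨e, rfl⟩ := Nat.exists_eq_succ_of_ne_zero he
    rw [pow_succ']; exact LinearMap.range_comp_le_range _ _
  obtain ⟨n, hn, x, hx⟩ := Module.exists_span_range_eq_top_of_length
    (B := B) (Q := M ⧸ LinearMap.range T) (by
      rintro y ⟨b, hb⟩
      obtain ⟨y, rfl⟩ := Submodule.Quotient.mk_surjective _ y
      change Submodule.Quotient.mk (b • y) = 0
      rw [Submodule.Quotient.mk_eq_zero]
      exact hle (hTe ▸ Submodule.smul_mem_smul hb trivial))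
  have hlen := Module.length_quotient_range_pow T hT e
  rw [hTe, Module.length_quotient_maximalIdeal_smul_top, hn] at hlen
  refine ⟨n, hn, by exact_mod_cast hlen, fun i => (x i).out, ?_⟩
  rw [sup_comm, ← Submodule.map_mkQ_eq_top, Submodule.map_span, ← hx, ← Set.range_comp]
  congr
  ext i
  simp

theorem PadicInt.ringHom_apply_eq_castHom {p : ℕ} [Fact p.Prime] {R : Type*} [CommRing R]
    [CharP R p] (g : ℤ_[p] →+* R) (z : ℤ_[p]) :
    g z = ZMod.castHom (dvd_refl p) R (PadicInt.toZMod z) := by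
  have hz : z - (z.zmodRepr : ℤ_[p]) ∈ IsLocalRing.maximalIdeal ℤ_[p] := z.sub_zmodRepr_mem
  rw [PadicInt.maximalIdeal_eq_span_p, Ideal.mem_span_singleton'] at hz
  obtain ⟨w, hw⟩ := hz
  have hz' : z = z.zmodRepr + w * p := by rw [hw]; ring
  rw [hz']
  simp

theorem PadicInt.ringHom_eq_comp_toZMod {p : ℕ} [Fact p.Prime] {R : Type*} [CommRing R]
    [CharP R p] (g : ℤ_[p] →+* R) :
    g = (ZMod.castHom (dvd_refl p) R).comp PadicInt.toZMod :=
  RingHom.ext (PadicInt.ringHom_apply_eq_castHom g)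

section FiniteOverPadicInt

variable (p : ℕ) [Fact p.Prime] (A : Type*) [CommRing A] [Algebra ℤ_[p] A]

theorem PadicInt.map_maximalIdeal_eq_span :
    (maximalIdeal ℤ_[p]).map (algebraMap ℤ_[p] A) = Ideal.span {(p : A)} := by
  rw [PadicInt.maximalIdeal_eq_span_p, Ideal.map_span]
  simp

variable [Module.Finite ℤ_[p] A]

theorem PadicInt.isAdicComplete_map_maximalIdeal :
    IsAdicComplete ((maximalIdeal ℤ_[p]).map (algebraMap ℤ_[p] A)) A :=
  IsAdicComplete.map_of_finite _

theorem PadicInt.finite_quotient_map_maximalIdeal :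
    Finite (A ⧸ (maximalIdeal ℤ_[p]).map (algebraMap ℤ_[p] A)) := by
  have : Finite (ℤ_[p] ⧸ maximalIdeal ℤ_[p]) :=
    Finite.of_equiv (ZMod p) (PadicInt.residueField (p := p)).symm.toEquiv
  have : Module.Finite (ℤ_[p] ⧸ maximalIdeal ℤ_[p])
      (A ⧸ (maximalIdeal ℤ_[p]).map (algebraMap ℤ_[p] A)) :=
    Module.Finite.of_restrictScalars_finite ℤ_[p] _ _
  exact Module.finite_of_finite (ℤ_[p] ⧸ maximalIdeal ℤ_[p])

theorem PadicInt.natCast_mem_maximalIdeal [IsLocalRing A] : (p : A) ∈ maximalIdeal A := by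
  have := PadicInt.isAdicComplete_map_maximalIdeal p A
  have h := IsAdicComplete.le_jacobson_bot ((maximalIdeal ℤ_[p]).map (algebraMap ℤ_[p] A))
  rw [PadicInt.map_maximalIdeal_eq_span, IsLocalRing.jacobson_eq_maximalIdeal _ bot_ne_top] at h
  exact h (Ideal.mem_span_singleton_self _)

theorem PadicInt.charP_residueField [IsLocalRing A] : CharP (ResidueField A) p := by
  refine (CharP.charP_iff_prime_eq_zero Fact.out).2 ?_
  rw [← map_natCast (residue A), residue_eq_zero_iff]
  exact PadicInt.natCast_mem_maximalIdeal p A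

theorem PadicInt.finite_residueField (p : ℕ) [Fact p.Prime] (A : Type*) [CommRing A]
    [Algebra ℤ_[p] A] [Module.Finite ℤ_[p] A] [IsLocalRing A] : Finite (ResidueField A) := by
  have := PadicInt.finite_quotient_map_maximalIdeal p A
  have hle : (maximalIdeal ℤ_[p]).map (algebraMap ℤ_[p] A) ≤ maximalIdeal A := by
    rw [PadicInt.map_maximalIdeal_eq_span, Ideal.span_singleton_le_iff_mem]
    exact PadicInt.natCast_mem_maximalIdeal p A
  exact Finite.of_surjective _ (Ideal.Quotient.factor_surjective hle)

theorem PadicInt.isLocalRing_of_finite (p : ℕ) [Fact p.Prime] (A : Type*) [CommRing A]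
    [Algebra ℤ_[p] A] [Module.Finite ℤ_[p] A] [IsDomain A] : IsLocalRing A :=
  have := PadicInt.isAdicComplete_map_maximalIdeal p A
  have := PadicInt.finite_quotient_map_maximalIdeal p A
  .of_henselianRing_of_finite_quotient ((maximalIdeal ℤ_[p]).map (algebraMap ℤ_[p] A))

/-- The length of the residue field is its degree over the prime field. -/
theorem PadicInt.card_residueField_eq_pow [IsLocalRing A] :
    ∃ f : ℕ, Module.length ℤ_[p] (ResidueField A) = f ∧ f ≠ 0 ∧
      Nat.card (ResidueField A) = p ^ f := by
  have := PadicInt.charP_residueField p A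
  have := PadicInt.finite_residueField p A
  let : Algebra (ZMod p) (ResidueField A) := ZMod.algebra _ p
  let : Algebra ℤ_[p] (ZMod p) := PadicInt.toZMod.toAlgebra
  have : IsScalarTower ℤ_[p] (ZMod p) (ResidueField A) := .of_algebraMap_eq' <| by
    rw [PadicInt.ringHom_eq_comp_toZMod (algebraMap ℤ_[p] (ResidueField A))]
    rfl
  refine ⟨Module.finrank (ZMod p) (ResidueField A), ?_, Module.finrank_pos.ne', ?_⟩
  · rw [← Module.length_eq_finrank]
    exact Module.length_eq_of_surjective (ZMod.ringHom_surjective _)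
  · rw [Module.natCard_eq_pow_finrank (K := ZMod p), Nat.card_zmod]

theorem PadicInt.exists_uniformizer [IsLocalRing A] [IsDedekindDomain A] [CharZero A] :
    ∃ (ϖ u : A) (e : ℕ), maximalIdeal A = Ideal.span {ϖ} ∧ IsUnit u ∧ e ≠ 0 ∧ ϖ ^ e * u = p := by
  have hp := PadicInt.natCast_mem_maximalIdeal p A
  have hp0 : (p : A) ≠ 0 := Nat.cast_ne_zero.2 (Fact.out : p.Prime).ne_zero
  have hF : ¬ IsField A := fun h => hp0 (by
    rwa [(IsLocalRing.isField_iff_maximalIdeal_eq).1 h, Ideal.mem_bot] at hp)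
  have : IsDiscreteValuationRing A :=
    ((IsDiscreteValuationRing.TFAE A hF).out 0 2).2 ‹IsDedekindDomain A›
  obtain ⟨ϖ, hϖ⟩ := IsDiscreteValuationRing.exists_irreducible A
  obtain ⟨e, he⟩ := IsDiscreteValuationRing.associated_pow_irreducible hp0 hϖ
  obtain ⟨u, hu⟩ := he.symm
  refine ⟨ϖ, u, e, hϖ.maximalIdeal_eq, u.isUnit, ?_, hu⟩
  rintro rfl
  rw [pow_zero, one_mul] at hu
  exact hp (hu ▸ u.isUnit)

theorem PadicInt.isAdicComplete_maximalIdeal (p : ℕ) [Fact p.Prime] (A : Type*) [CommRing A]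
    [Algebra ℤ_[p] A] [Module.Finite ℤ_[p] A] [IsLocalRing A] [IsDedekindDomain A] [CharZero A] :
    IsAdicComplete (maximalIdeal A) A := by
  obtain ⟨ϖ, u, e, hm, hu, he, h⟩ := PadicInt.exists_uniformizer p A
  have := PadicInt.isAdicComplete_map_maximalIdeal p A
  refine IsAdicComplete.of_pow_le (I := (maximalIdeal ℤ_[p]).map (algebraMap ℤ_[p] A)) (n := e)
    ?_ ?_ he
  · rw [PadicInt.map_maximalIdeal_eq_span, Ideal.span_singleton_le_iff_mem]
    exact PadicInt.natCast_mem_maximalIdeal p A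
  · rw [PadicInt.map_maximalIdeal_eq_span, hm, Ideal.span_singleton_pow,
      Ideal.span_singleton_le_span_singleton, ← h]
    exact (associated_mul_unit_left _ _ hu).dvd

/-- The fundamental identity `[A : ℤ_p] = e * f` for a local Dedekind domain `A`. -/
theorem PadicInt.finrank_eq_mul [IsDomain A] [IsLocalRing A] [CharZero A] [Module.Free ℤ_[p] A]
    {ϖ u : A} {e f : ℕ} (hm : maximalIdeal A = Ideal.span {ϖ}) (hu : IsUnit u) (he : e ≠ 0)
    (h : ϖ ^ e * u = p) (hf : Module.length ℤ_[p] (ResidueField A) = f) :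
    Module.finrank ℤ_[p] A = e * f := by
  have hp0 : (p : A) ≠ 0 := Nat.cast_ne_zero.2 (Fact.out : p.Prime).ne_zero
  have hϖ : ϖ ≠ 0 := by
    rintro rfl
    exact hp0 (by rw [← h, zero_pow he, zero_mul])
  obtain ⟨n, hn, hfin, -⟩ := Module.End.exists_generators_mod_range
    (LinearMap.mulLeft ℤ_[p] ϖ) (mul_right_injective₀ hϖ) he (by
      rw [LinearMap.pow_mulLeft, PadicInt.maximalIdeal_eq_span_p,
        Submodule.ideal_span_singleton_smul]
      ext x
      rw [Submodule.mem_smul_pointwise_iff_exists]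
      obtain ⟨u, rfl⟩ := hu
      constructor
      · rintro ⟨y, rfl⟩
        refine ⟨↑u⁻¹ * y, trivial, ?_⟩
        rw [Algebra.smul_def, map_natCast, ← h]
        simp [mul_assoc]
      · rintro ⟨y, -, rfl⟩
        refine ⟨u * y, ?_⟩
        rw [Algebra.smul_def, map_natCast, ← h]
        simp [mul_assoc])
  let g : A →ₗ[ℤ_[p]] ResidueField A :=
    (Algebra.ofId A (ResidueField A)).toLinearMap.restrictScalars ℤ_[p]
  have hg : LinearMap.ker g = LinearMap.range (LinearMap.mulLeft ℤ_[p] ϖ) := by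
    ext x
    change residue A x = 0 ↔ _
    rw [residue_eq_zero_iff, hm, Ideal.mem_span_singleton]
    exact ⟨fun ⟨y, hy⟩ => ⟨y, hy.symm⟩, fun ⟨y, hy⟩ => ⟨y, hy.symm⟩⟩
  rw [← hg, (g.quotKerEquivOfSurjective residue_surjective).length_eq, hf] at hn
  rw [hfin, Nat.cast_injective hn]

end FiniteOverPadicInt

section
open Polynomial

/-- A finite field embeds in every algebraically closed field of the same characteristic, and the
image `a` of a generator of its unit group has distinct conjugates `a ^ p ^ i`. -/
theorem FiniteField.exists_primitive_root (p : ℕ) [Fact p.Prime] (κ k : Type*) [Field κ] [Finite κ]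
    [Algebra (ZMod p) κ] [Field k] [IsAlgClosed k] [Algebra (ZMod p) k] {f : ℕ}
    (hf : Nat.card κ = p ^ f) :
    ∃ (θ : κ) (τ : κ →ₐ[ZMod p] k), τ θ ^ p ^ f = τ θ ∧
      ∀ i < f, ∀ j < f, τ θ ^ p ^ i = τ θ ^ p ^ j → i = j := by
  have hp : p.Prime := Fact.out
  obtain ⟨θ, hθ⟩ := IsCyclic.exists_ofOrder_eq_natCard (α := κˣ)
  rw [Nat.card_units, hf] at hθ
  have : Algebra.IsAlgebraic (ZMod p) κ := .of_finite _ _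
  refine ⟨θ, IsAlgClosed.lift, ?_, fun i hi j hj h => ?_⟩
  · rw [← map_pow, ← hf]
    have := Fintype.ofFinite κ
    rw [Nat.card_eq_fintype_card, FiniteField.pow_card]
  · rw [← map_pow, ← map_pow] at h
    have h' := (IsAlgClosed.lift : κ →ₐ[ZMod p] k).toRingHom.injective h
    rcases Nat.lt_or_ge f 2 with hf2 | hf2
    · omega
    have key : ∀ i < f, p ^ i < orderOf θ := fun i hi => by
      rw [hθ]
      obtain ⟨g, rfl⟩ : ∃ g, f = g + 1 := ⟨f - 1, by omega⟩
      have h1 : p ^ i ≤ p ^ g := Nat.pow_le_pow_right hp.pos (by omega)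
      have h2 : 2 ≤ p ^ g := hp.two_le.trans (Nat.le_self_pow (by omega) p)
      have h3 : p ^ g * 2 ≤ p ^ (g + 1) := Nat.mul_le_mul_left _ hp.two_le
      omega
    exact Nat.pow_right_injective hp.two_le
      (pow_injOn_Iio_orderOf (key i hi) (key j hj) (Units.ext (by simpa using h')))

/-- A finite local Dedekind `ℤ_p`-algebra contains a root of a polynomial over `ℤ_p` whose
reduction is separable of degree the residue degree. -/
theorem PadicInt.exists_monic_root (p : ℕ) [Fact p.Prime] (A : Type*) [CommRing A]
    [Algebra ℤ_[p] A] [Module.Finite ℤ_[p] A] [IsLocalRing A] [IsDedekindDomain A] [CharZero A] {f : ℕ}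
    (hf : Nat.card (ResidueField A) = p ^ f) {k : Type*} [Field k] [IsAlgClosed k] [CharP k p]
    (g : ℤ_[p] →+* k) :
    ∃ (H : ℤ_[p][X]) (ζ : A) (a : k), H.Monic ∧ H.natDegree ≤ f ∧ aeval ζ H = 0 ∧
      (H.map g).eval a = 0 ∧ (H.map g).derivative.eval a ≠ 0 ∧ a ^ p ^ f = a ∧
      ∀ i < f, ∀ j < f, a ^ p ^ i = a ^ p ^ j → i = j := by
  have := PadicInt.charP_residueField p A
  have := PadicInt.finite_residueField p A
  let : Algebra (ZMod p) (ResidueField A) := ZMod.algebra _ p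
  let : Algebra (ZMod p) k := ZMod.algebra _ p
  obtain ⟨θ, τ, h1, h2⟩ := FiniteField.exists_primitive_root p (ResidueField A) k hf
  have hint : IsIntegral (ZMod p) θ := .of_finite _ _
  obtain ⟨H, hH, hdeg, hmon⟩ := lifts_and_natDegree_eq_and_monic
    (f := (PadicInt.toZMod : ℤ_[p] →+* ZMod p)) (p := minpoly (ZMod p) θ)
    ((mem_lifts _).2 (map_surjective _ (ZMod.ringHom_surjective _) _)) (minpoly.monic hint)
  have hsep : (minpoly (ZMod p) θ).Separable :=
    PerfectField.separable_of_irreducible (minpoly.irreducible hint)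
  have hmapA : H.map (algebraMap ℤ_[p] (ResidueField A)) =
      (minpoly (ZMod p) θ).map (algebraMap (ZMod p) (ResidueField A)) := by
    rw [PadicInt.ringHom_eq_comp_toZMod (algebraMap ℤ_[p] (ResidueField A)),
      ← Polynomial.map_map, hH]
    rfl
  have hmapk : H.map g = (minpoly (ZMod p) θ).map (algebraMap (ZMod p) k) := by
    rw [PadicInt.ringHom_eq_comp_toZMod g, ← Polynomial.map_map, hH]
    rfl
  have := PadicInt.isAdicComplete_maximalIdeal p A
  obtain ⟨ζ₀, hζ₀⟩ := residue_surjective θ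
  have hred : (H.map (algebraMap ℤ_[p] A)).map (residue A) =
      (minpoly (ZMod p) θ).map (algebraMap (ZMod p) (ResidueField A)) := by
    rw [Polynomial.map_map, ← hmapA]
    rfl
  obtain ⟨ζ, hζ, -⟩ := HenselianRing.is_henselian (I := maximalIdeal A)
    (H.map (algebraMap ℤ_[p] A)) (hmon.map _) ζ₀
    (by
      rw [← residue_eq_zero_iff, ← Polynomial.eval_map_apply, hred, hζ₀, eval_map_algebraMap,
        minpoly.aeval])
    (by
      change IsUnit (residue A _)
      rw [isUnit_iff_ne_zero, ← Polynomial.eval_map_apply, ← derivative_map, hred, hζ₀,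
        derivative_map, eval_map_algebraMap]
      exact hsep.aeval_derivative_ne_zero (minpoly.aeval _ _))
  have hτ : aeval (τ θ) (minpoly (ZMod p) θ) = 0 := by
    rw [aeval_algHom_apply, minpoly.aeval, map_zero]
  refine ⟨H, ζ, τ θ, hmon, ?_, ?_, ?_, ?_, h1, h2⟩
  · rw [hdeg]
    refine (minpoly.natDegree_le θ).trans (Nat.pow_right_injective (Fact.out : p.Prime).two_le ?_).le
    change p ^ _ = p ^ f
    rw [← hf, Module.natCard_eq_pow_finrank (K := ZMod p), Nat.card_zmod]
  · rwa [IsRoot.def, eval_map_algebraMap] at hζ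
  · rw [hmapk, eval_map_algebraMap, hτ]
  · rw [hmapk, derivative_map, eval_map_algebraMap]
    exact hsep.aeval_derivative_ne_zero hτ

end

section
open Polynomial

theorem WittVector.frobenius_algebraMap_padicInt (p : ℕ) [Fact p.Prime] (k : Type*) [Field k]
    [CharP k p] (z : ℤ_[p]) :
    WittVector.frobenius (algebraMap ℤ_[p] (WittVector p k) z) =
      algebraMap ℤ_[p] (WittVector p k) z := by
  change WittVector.frobenius (WittVector.map (ZMod.castHom (dvd_refl p) k) _) =
    WittVector.map (ZMod.castHom (dvd_refl p) k) _
  rw [WittVector.frobenius_eq_map_frobenius]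
  ext n
  rw [WittVector.map_coeff, WittVector.map_coeff, frobenius_def, ← map_pow, ZMod.pow_card]

theorem WittVector.isUnit_sub_of_coeff_zero_ne {p : ℕ} [Fact p.Prime] {k : Type*} [Field k]
    [CharP k p] {x y : WittVector p k} (h : x.coeff 0 ≠ y.coeff 0) : IsUnit (x - y) := by
  refine WittVector.isUnit_of_coeff_zero_ne_zero _ ?_
  rw [← WittVector.constantCoeff_apply, map_sub]
  exact sub_ne_zero.2 h

/-- A polynomial over `ℤ_p` with a simple root in `k` splits over `𝕎 k`, with roots permuted
cyclically by Frobenius, if its degree is at most the number of conjugates of that root. -/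
theorem WittVector.exists_frobenius_cycle (p : ℕ) [Fact p.Prime] (k : Type*) [Field k]
    [IsAlgClosed k] [CharP k p] {f : ℕ} (hf : f ≠ 0) {H : ℤ_[p][X]} (hH : H.Monic)
    (hdeg : H.natDegree ≤ f) {a : k}
    (ha : (H.map (WittVector.constantCoeff.comp (algebraMap ℤ_[p] (WittVector p k)))).eval a = 0)
    (ha' : (H.map (WittVector.constantCoeff.comp
      (algebraMap ℤ_[p] (WittVector p k)))).derivative.eval a ≠ 0)
    (hfix : a ^ p ^ f = a) (hinj : ∀ i < f, ∀ j < f, a ^ p ^ i = a ^ p ^ j → i = j) :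
    ∃ w : ℕ → WittVector p k, (∀ i, WittVector.frobeniusEquiv p k (w i) = w (i + 1)) ∧
      w f = w 0 ∧ (∀ i < f, ∀ j < f, i ≠ j → IsUnit (w i - w j)) ∧
      H.map (algebraMap ℤ_[p] (WittVector p k)) = ∏ i ∈ Finset.range f, (X - C (w i)) := by
  set P := H.map (algebraMap ℤ_[p] (WittVector p k)) with hP
  have hPa : P.map WittVector.constantCoeff =
      H.map (WittVector.constantCoeff.comp (algebraMap ℤ_[p] (WittVector p k))) := by
    rw [hP, Polynomial.map_map]
  have hPm : P.Monic := hH.map _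
  have hmem (x : WittVector p k) :
      x ∈ Ideal.span {(p : WittVector p k)} ↔ WittVector.constantCoeff x = 0 :=
    WittVector.mem_span_p_iff_coeff_zero_eq_zero x
  have hcc : WittVector.constantCoeff (WittVector.teichmuller p a) = a :=
    WittVector.teichmuller_coeff_zero p a
  obtain ⟨w₀, hroot, hw₀⟩ := HenselianRing.is_henselian (I := Ideal.span {(p : WittVector p k)}) P
    hPm (WittVector.teichmuller p a)
    (by rw [hmem, ← Polynomial.eval_map_apply, hPa, hcc, ha])
    (by
      refine (WittVector.isUnit_of_coeff_zero_ne_zero _ ?_).map _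
      rw [← WittVector.constantCoeff_apply, ← Polynomial.eval_map_apply, ← derivative_map, hPa, hcc]
      exact ha')
  rw [hmem, map_sub, hcc, sub_eq_zero] at hw₀
  let w : ℕ → WittVector p k := fun i => WittVector.frobenius^[i] w₀
  have hw (i : ℕ) : WittVector.frobenius (w i) = w (i + 1) :=
    (Function.iterate_succ_apply' _ _ _).symm
  have hcoeff (i : ℕ) : (w i).coeff 0 = a ^ p ^ i := by
    induction i with
    | zero => rw [pow_zero, pow_one]; exact hw₀
    | succ i ih => rw [← hw, WittVector.coeff_frobenius_charP, ih, ← pow_mul, pow_succ]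
  have hwroot (i : ℕ) : P.IsRoot (w i) := by
    induction i with
    | zero => exact hroot
    | succ i ih =>
      have := ih.map (f := (WittVector.frobenius : WittVector p k →+* WittVector p k))
      rw [hP, Polynomial.map_map, show WittVector.frobenius.comp (algebraMap ℤ_[p] _) =
        algebraMap ℤ_[p] (WittVector p k) from
          RingHom.ext (WittVector.frobenius_algebraMap_padicInt p k), hw] at this
      exact this
  have hunit : ∀ i < f, ∀ j < f, i ≠ j → IsUnit (w i - w j) := fun i hi j hj hij =>
    WittVector.isUnit_sub_of_coeff_zero_ne fun h => hij <| hinj i hi j hj <| by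
      rwa [hcoeff, hcoeff] at h
  have hprod : P = ∏ i ∈ Finset.range f, (X - C (w i)) := by
    refine Polynomial.eq_of_monic_of_dvd_of_natDegree_le
      (monic_prod_of_monic _ _ fun i _ => monic_X_sub_C (w i)) hPm ?_ ?_
    · refine Finset.prod_dvd_of_coprime (fun i hi j hj hij => ?_) fun i _ =>
        dvd_iff_isRoot.2 (hwroot i)
      exact isCoprime_X_sub_C_of_isUnit_sub
        (hunit i (Finset.mem_range.1 hi) j (Finset.mem_range.1 hj) hij)
    · rw [natDegree_prod_of_monic _ _ fun i _ => monic_X_sub_C (w i)]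
      simpa using (natDegree_map_le).trans hdeg
  refine ⟨w, hw, ?_, hunit, hprod⟩
  have h := hwroot f
  rw [hprod, IsRoot.def, eval_prod, Finset.prod_eq_zero_iff] at h
  obtain ⟨i, hi, h⟩ := h
  rw [eval_sub, eval_X, eval_C, sub_eq_zero] at h
  have hi0 : i = 0 := hinj i (Finset.mem_range.1 hi) 0 (Nat.pos_of_ne_zero hf) <| by
    rw [← hcoeff, ← h, hcoeff, hfix, pow_zero, pow_one]
  rw [h, hi0]

end

section
open Polynomial

theorem Module.End.isInternal_eigenspace_of_aeval_prod_eq_zero {B M ι : Type*} [CommRing B]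
    [IsDomain B] [AddCommGroup M] [Module B M] [Module.IsTorsionFree B M] [Fintype ι]
    [DecidableEq ι] (T : Module.End B M) {w : ι → B}
    (hw : Pairwise fun i j => IsUnit (w i - w j)) (hT : aeval T (∏ i, (X - C (w i))) = 0) :
    DirectSum.IsInternal fun i => T.eigenspace (w i) := by
  have hinj : Function.Injective w := fun i j hij => by
    by_contra h
    simpa [hij] using hw h
  refine DirectSum.isInternal_submodule_of_iSupIndep_of_iSup_eq_top
    (T.eigenspaces_iSupIndep.comp hinj) (eq_top_iff.2 fun x _ => ?_)
  rcases isEmpty_or_nonempty ι with hι | hι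
  · rw [Finset.prod_of_isEmpty, map_one] at hT
    rw [← Module.End.one_apply (R := B) x, hT]
    exact zero_mem _
  obtain ⟨μ, hμ⟩ := (exists_sum_eq_one_iff_pairwise_coprime'
    (s := fun i => X - C (w i))).2 fun i j hij => isCoprime_X_sub_C_of_isUnit_sub (hw hij)
  have hx : ∑ i, aeval T (μ i * ∏ j ∈ {i}ᶜ, (X - C (w j))) x = x := by
    rw [← LinearMap.sum_apply, ← map_sum, hμ, map_one, Module.End.one_apply]
  rw [← hx]
  refine Submodule.sum_mem _ fun i _ => Submodule.mem_iSup_of_mem i ?_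
  have h0 : aeval T ((X - C (w i)) * (μ i * ∏ j ∈ {i}ᶜ, (X - C (w j)))) = 0 := by
    rw [← Finset.prod_mul_prod_compl {i}, Finset.prod_singleton] at hT
    rw [mul_left_comm, map_mul, hT, mul_zero]
  rw [Module.End.mem_eigenspace_iff, ← sub_eq_zero]
  rw [map_mul] at h0
  simpa [Module.End.mul_apply] using LinearMap.congr_fun h0 x

theorem Module.End.mem_of_sum_eigenvectors_mem {B M ι : Type*} [CommRing B] [AddCommGroup M]
    [Module B M] [Fintype ι] {T : Module.End B M} {w : ι → B}
    (hw : Pairwise fun i j => IsUnit (w i - w j)) {N : Submodule B M} (hN : ∀ x ∈ N, T x ∈ N)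
    {x : ι → M} (hx : ∀ i, x i ∈ T.eigenspace (w i)) (hsum : ∑ i, x i ∈ N) (i : ι) : x i ∈ N := by
  classical
  have hNP (P : B[X]) : ∀ y ∈ N, aeval T P y ∈ N := fun y hy => by
    induction P using Polynomial.induction_on' with
    | add P Q hP hQ => rw [map_add]; exact add_mem hP hQ
    | monomial n b =>
      rw [aeval_monomial, Module.End.mul_apply, algebraMap_end_apply]
      refine N.smul_mem _ ?_
      induction n with
      | zero => simpa
      | succ n ih => rw [pow_succ', Module.End.mul_apply]; exact hN _ ih
  have h := hNP (∏ j ∈ Finset.univ.erase i, (X - C (w j))) _ hsum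
  rw [map_sum, Finset.sum_eq_single i] at h
  · rw [Module.End.aeval_apply_of_mem_apply_eq_smul (Module.End.mem_eigenspace_iff.1 (hx i)),
      eval_prod] at h
    refine (Submodule.smul_mem_iff_of_isUnit N ?_).1 h
    rw [IsUnit.prod_iff]
    intro j hj
    simpa using hw (Finset.ne_of_mem_erase hj).symm
  · intro j _ hj
    rw [Module.End.aeval_apply_of_mem_apply_eq_smul (Module.End.mem_eigenspace_iff.1 (hx j)),
      eval_prod, Finset.prod_eq_zero (Finset.mem_erase.2 ⟨hj, Finset.mem_univ j⟩), zero_smul]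
    simp
  · simp

end

section Uniformizer

variable {A B M : Type*} [CommRing A] [CommRing B] [AddCommGroup M] [Module B M]
  (ρ : A →+* Module.End B M) {ϖ u : A} {e p : ℕ}

theorem Module.End.map_pow_comp_eq_natCast (h : ϖ ^ e * u = p) (x : M) :
    (ρ ϖ ^ e) (ρ u x) = (p : B) • x := by
  rw [← map_pow, ← Module.End.mul_apply, ← map_mul, h, map_natCast, Module.End.natCast_apply,
    Nat.cast_smul_eq_nsmul]

theorem Module.End.range_pow_eq_smul_top (hu : IsUnit u) (h : ϖ ^ e * u = p) :
    LinearMap.range (ρ ϖ ^ e) = Ideal.span {(p : B)} • ⊤ := by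
  rw [Submodule.ideal_span_singleton_smul]
  ext x
  rw [Submodule.mem_smul_pointwise_iff_exists]
  obtain ⟨u, rfl⟩ := hu
  constructor
  · rintro ⟨y, rfl⟩
    refine ⟨ρ ↑u⁻¹ y, trivial, ?_⟩
    rw [← Module.End.map_pow_comp_eq_natCast ρ h, ← Module.End.mul_apply (ρ u), ← map_mul]
    simp
  · rintro ⟨y, -, rfl⟩
    exact ⟨ρ u y, Module.End.map_pow_comp_eq_natCast ρ h y⟩

theorem Module.End.injective_of_pow_mul_eq [IsDomain B] [Module.IsTorsionFree B M] (he : e ≠ 0)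
    (hp : (p : B) ≠ 0) (h : ϖ ^ e * u = p) : Function.Injective (ρ ϖ) := by
  rw [injective_iff_map_eq_zero]
  intro x hx
  obtain ⟨e, rfl⟩ := Nat.exists_eq_succ_of_ne_zero he
  have := Module.End.map_pow_comp_eq_natCast (B := B) ρ h x
  rw [← map_pow, ← Module.End.mul_apply, ← map_mul, mul_comm, pow_succ, ← mul_assoc, map_mul,
    Module.End.mul_apply, hx, map_zero, eq_comm, smul_eq_zero_iff_right hp] at this
  exact this

theorem Module.End.eq_top_of_sup_range_eq_top [IsLocalRing B] [Module.Finite B M]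
    (hB : maximalIdeal B = Ideal.span {(p : B)}) (hu : IsUnit u) (h : ϖ ^ e * u = p)
    {N : Submodule B M} (hN : ∀ x ∈ N, ρ ϖ x ∈ N) (hsup : N ⊔ LinearMap.range (ρ ϖ) = ⊤) :
    N = ⊤ := by
  have hpow (j : ℕ) : N ⊔ LinearMap.range (ρ ϖ ^ j) = ⊤ := by
    induction j with
    | zero => simp [Module.End.one_eq_id]
    | succ j ih =>
      refine eq_top_iff.2 fun x _ => ?_
      obtain ⟨a, ha, _, ⟨b, rfl⟩, rfl⟩ := Submodule.mem_sup.1 (hsup ▸ trivial :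
        x ∈ N ⊔ LinearMap.range (ρ ϖ))
      obtain ⟨c, hc, _, ⟨d, rfl⟩, rfl⟩ := Submodule.mem_sup.1 (ih ▸ trivial :
        b ∈ N ⊔ LinearMap.range (ρ ϖ ^ j))
      rw [map_add, ← add_assoc, ← Module.End.mul_apply, ← pow_succ']
      exact Submodule.add_mem_sup (add_mem ha (hN c hc)) ⟨d, rfl⟩
  have htop := hpow e
  rw [Module.End.range_pow_eq_smul_top ρ hu h, ← hB] at htop
  exact top_le_iff.1 (Submodule.le_of_le_smul_of_le_jacobson_bot Module.Finite.fg_top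
    (IsLocalRing.maximalIdeal_le_jacobson ⊥) htop.ge)

theorem Module.End.exists_generators_of_pow_mul_eq [IsDomain B] [IsLocalRing B] [Module.Finite B M]
    [Module.Free B M] (hB : maximalIdeal B = Ideal.span {(p : B)}) (hp : (p : B) ≠ 0) (he : e ≠ 0)
    (hu : IsUnit u) (h : ϖ ^ e * u = p) :
    ∃ n : ℕ, Module.finrank B M = e * n ∧
      ∃ x : Fin n → M, Submodule.span B (Set.range x) ⊔ LinearMap.range (ρ ϖ) = ⊤ := by
  obtain ⟨n, -, hn⟩ := Module.End.exists_generators_mod_range (ρ ϖ)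
    (Module.End.injective_of_pow_mul_eq ρ he hp h) he
    ((Module.End.range_pow_eq_smul_top ρ hu h).trans (by rw [hB]))
  exact ⟨n, hn⟩

end Uniformizer

section
open Polynomial

/-- The action of a commutative ring on an eigenspace of one of its elements. -/
def Module.End.restrictEigenspace {A B M : Type*} [CommRing A] [CommRing B] [AddCommGroup M]
    [Module B M] (ρ : A →+* Module.End B M) (ζ : A) (c : B) :
    A →+* Module.End B ((ρ ζ).eigenspace c) where
  toFun a := (ρ a).restrict (p := (ρ ζ).eigenspace c) (q := (ρ ζ).eigenspace c) fun x hx => by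
    rw [Module.End.mem_eigenspace_iff] at hx ⊢
    rw [← Module.End.mul_apply, ← map_mul, mul_comm, map_mul, Module.End.mul_apply, hx, map_smul]
  map_one' := by ext; simp
  map_mul' a b := by ext; simp
  map_zero' := by ext; simp
  map_add' a b := by ext; simp

theorem Module.End.exists_generators_of_eigenspaces {A B M ι : Type*} [CommRing A] [CommRing B]
    [IsDomain B] [IsPrincipalIdealRing B] [IsLocalRing B] [AddCommGroup M] [Module B M]
    [Module.Finite B M] [Module.Free B M] [Fintype ι] [Nonempty ι] (ρ : A →+* Module.End B M)
    {ϖ u ζ : A} {e p : ℕ} (hB : maximalIdeal B = Ideal.span {(p : B)}) (hp : (p : B) ≠ 0)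
    (he : e ≠ 0) (hu : IsUnit u) (h : ϖ ^ e * u = p) {w : ι → B}
    (hw : Pairwise fun i j => IsUnit (w i - w j))
    (hζ : aeval (ρ ζ) (∏ i, (X - C (w i))) = 0)
    (hrank : ∀ i j, Module.finrank B ((ρ ζ).eigenspace (w i)) =
      Module.finrank B ((ρ ζ).eigenspace (w j))) :
    ∃ n : ℕ, Module.finrank B M = e * Fintype.card ι * n ∧ ∃ y : Fin n → M,
      ∀ N : Submodule B M, (∀ a, ∀ x ∈ N, ρ a x ∈ N) → (∀ j, y j ∈ N) → N = ⊤ := by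
  classical
  have hint := Module.End.isInternal_eigenspace_of_aeval_prod_eq_zero (ρ ζ) hw hζ
  have key (i : ι) := Module.End.exists_generators_of_pow_mul_eq
    (Module.End.restrictEigenspace ρ ζ (w i)) hB hp he hu h
  choose n hn x hx using key
  have i₀ : ι := Classical.arbitrary ι
  obtain ⟨n₀, rfl⟩ : ∃ n₀, n = fun _ => n₀ := ⟨n i₀, funext fun i =>
    Nat.eq_of_mul_eq_mul_left (Nat.pos_of_ne_zero he) (by rw [← hn, ← hn, hrank])⟩
  refine ⟨n₀, ?_, fun j => ∑ i, (x i j : M), fun N hN hy => ?_⟩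
  · rw [← (LinearEquiv.ofBijective (DirectSum.coeLinearMap _) hint).finrank_eq,
      Module.finrank_directSum, Finset.sum_congr rfl fun i _ => hn i]
    simp
    ring
  · have hxN (i : ι) (j : Fin n₀) : (x i j : M) ∈ N :=
      Module.End.mem_of_sum_eigenvectors_mem hw (hN ζ) (x := fun i => (x i j : M))
        (fun i => (x i j).2) (hy j) i
    refine Module.End.eq_top_of_sup_range_eq_top ρ hB hu h (hN ϖ) ?_
    rw [eq_top_iff, ← hint.submodule_iSup_eq_top, iSup_le_iff]
    intro i
    have hmap := congrArg (Submodule.map ((ρ ζ).eigenspace (w i)).subtype) (hx i)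
    rw [Submodule.map_sup, Submodule.map_top, Submodule.range_subtype, Submodule.map_span] at hmap
    rw [← hmap]
    refine sup_le_sup (Submodule.span_le.2 ?_) ?_
    · rintro _ ⟨_, ⟨j, rfl⟩, rfl⟩
      exact hxN i j
    · rintro _ ⟨_, ⟨z, rfl⟩, rfl⟩
      exact ⟨z, rfl⟩

end

theorem Module.End.finrank_eigenspace_le_of_semilinear {B M : Type*} [CommRing B] [IsDomain B]
    [IsPrincipalIdealRing B] [AddCommGroup M] [Module B M] [Module.Finite B M] [Module.Free B M]
    (σ : B ≃+* B) (φ : M →+ M) (hφ : Function.Injective φ)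
    (hσ : ∀ (c : B) (x : M), φ (c • x) = σ c • φ x) {T : Module.End B M}
    (hT : ∀ x, φ (T x) = T (φ x)) (c : B) :
    Module.finrank B (T.eigenspace c) ≤ Module.finrank B (T.eigenspace (σ c)) := by
  let φ' : T.eigenspace c →+ T.eigenspace (σ c) :=
    { toFun := fun x => ⟨φ x, by
        have hx := x.2
        rw [Module.End.mem_eigenspace_iff] at hx ⊢
        rw [← hT, hx, hσ]⟩
      map_zero' := Subtype.ext (map_zero φ)
      map_add' := fun x y => Subtype.ext (map_add φ _ _) }
  have h := rank_le_of_surjective_injective (R := B) (R' := B) σ φ' σ.surjective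
    (fun x y hxy => Subtype.ext (hφ (congrArg Subtype.val hxy)))
    (fun r x => Subtype.ext (hσ r x))
  rwa [← Module.finrank_eq_rank, ← Module.finrank_eq_rank, Nat.cast_le] at h

theorem Nat.eq_of_le_succ_of_cycle {r : ℕ → ℕ} {f : ℕ} (h : ∀ i, r i ≤ r (i + 1))
    (hf : r f = r 0) {i j : ℕ} (hi : i ≤ f) (hj : j ≤ f) : r i = r j := by
  have hm : Monotone r := monotone_nat_of_le_succ h
  have key {i : ℕ} (hi : i ≤ f) : r i = r 0 := le_antisymm (hf ▸ hm hi) (hm (Nat.zero_le i))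
  rw [key hi, key hj]

section TensorProduct

variable {Z A B M : Type*} [CommRing Z] [CommRing A] [CommRing B] [Algebra Z A] [Algebra Z B]
  [AddCommGroup M] [Module B M] {ρ : A →+* Module.End B M}

theorem Submodule.span_range_map_basis_eq_top {ι κ : Type*} [Fintype ι] (β : Module.Basis ι Z A)
    (hρ : ∀ z : Z, ρ (algebraMap Z A z) = algebraMap Z B z • (1 : Module.End B M))
    {y : κ → M}
    (hy : ∀ N : Submodule B M, (∀ a, ∀ x ∈ N, ρ a x ∈ N) → (∀ j, y j ∈ N) → N = ⊤) :
    Submodule.span B (Set.range fun q : ι × κ => ρ (β q.1) (y q.2)) = ⊤ := by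
  set N := Submodule.span B (Set.range fun q : ι × κ => ρ (β q.1) (y q.2)) with hN
  have hmem (a : A) (j : κ) : ρ a (y j) ∈ N := by
    rw [← β.sum_repr a, map_sum, LinearMap.sum_apply]
    refine Submodule.sum_mem _ fun s _ => ?_
    rw [Algebra.smul_def, map_mul, hρ, Module.End.mul_apply, LinearMap.smul_apply,
      Module.End.one_apply]
    exact N.smul_mem _ (Submodule.subset_span ⟨(s, j), rfl⟩)
  refine hy N (fun a x hx => ?_) fun j => ?_
  · induction hx using Submodule.span_induction with
    | mem x hx =>
      obtain ⟨q, rfl⟩ := hx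
      rw [← Module.End.mul_apply, ← map_mul]
      exact hmem _ _
    | zero => simp
    | add x y _ _ hx hy => rw [map_add]; exact add_mem hx hy
    | smul c x _ hx => rw [map_smul]; exact N.smul_mem c hx
  · simpa using hmem 1 j

theorem TensorProduct.exists_eq_sum_basis_tmul {ι : Type*} [Fintype ι] (β : Module.Basis ι Z A)
    (r : A ⊗[Z] B) : ∃ c : ι → B, r = ∑ s, β s ⊗ₜ c s := by
  induction r with
  | zero => exact ⟨0, by simp⟩
  | tmul a b =>
    refine ⟨fun s => β.repr a s • b, ?_⟩
    conv_lhs => rw [← β.sum_repr a, TensorProduct.sum_tmul]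
    simp only [TensorProduct.smul_tmul]
  | add x y hx hy =>
    obtain ⟨c, rfl⟩ := hx
    obtain ⟨d, rfl⟩ := hy
    exact ⟨c + d, by simp [TensorProduct.tmul_add, Finset.sum_add_distrib]⟩

/-- A module over `A ⊗ B` generated by `rank_B M / rank_Z A` elements is free. -/
theorem Module.free_tensorProduct_of_generators [Nontrivial B] [Nontrivial Z] [Module.Finite Z A]
    [Module.Free Z A] [Module.Finite B M] [Module.Free B M] [Module (A ⊗[Z] B) M]
    (hsmul : ∀ (a : A) (b : B) (x : M), (a ⊗ₜ[Z] b) • x = ρ a (b • x))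
    (hρ : ∀ z : Z, ρ (algebraMap Z A z) = algebraMap Z B z • (1 : Module.End B M))
    {n : ℕ} (hn : Module.finrank B M = Module.finrank Z A * n) {y : Fin n → M}
    (hy : ∀ N : Submodule B M, (∀ a, ∀ x ∈ N, ρ a x ∈ N) → (∀ j, y j ∈ N) → N = ⊤) :
    Module.Free (A ⊗[Z] B) M := by
  let β := Module.finBasis Z A
  have hspan := Submodule.span_range_map_basis_eq_top β hρ hy
  have hli : LinearIndependent B fun q : Fin (Module.finrank Z A) × Fin n => ρ (β q.1) (y q.2) :=
    linearIndependent_of_top_le_span_of_card_le_finrank hspan.ge (by simp [hn])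
  have htmul (c : Fin (Module.finrank Z A) → B) (x : M) :
      (∑ s, β s ⊗ₜ[Z] c s) • x = ∑ s, c s • ρ (β s) x := by
    simp only [Finset.sum_smul, hsmul, map_smul]
  have hyli : LinearIndependent (A ⊗[Z] B) y := by
    rw [Fintype.linearIndependent_iff]
    intro g hg j
    choose c hc using fun j => TensorProduct.exists_eq_sum_basis_tmul β (g j)
    have h0 : ∑ q : Fin (Module.finrank Z A) × Fin n, c q.2 q.1 • ρ (β q.1) (y q.2) = 0 := by
      rw [Fintype.sum_prod_type_right, ← hg]
      refine Finset.sum_congr rfl fun j _ => ?_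
      rw [hc j, htmul]
    have hc0 := Fintype.linearIndependent_iff.1 hli (fun q => c q.2 q.1) h0
    rw [hc j]
    exact Finset.sum_eq_zero fun s _ => by rw [hc0 (s, j), TensorProduct.tmul_zero]
  refine Module.Free.of_basis (Module.Basis.mk hyli fun x _ => ?_)
  have hx : x ∈ Submodule.span B
      (Set.range fun q : Fin (Module.finrank Z A) × Fin n => ρ (β q.1) (y q.2)) := hspan ▸ trivial
  induction hx using Submodule.span_induction with
  | mem x hx =>
    obtain ⟨q, rfl⟩ := hx
    have := Submodule.smul_mem (Submodule.span (A ⊗[Z] B) (Set.range y)) (β q.1 ⊗ₜ 1)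
      (Submodule.subset_span ⟨q.2, rfl⟩)
    rwa [hsmul, one_smul] at this
  | zero => exact zero_mem _
  | add x y _ _ hx hy => exact add_mem (hx trivial) (hy trivial)
  | smul c x _ hx =>
    have := Submodule.smul_mem (Submodule.span (A ⊗[Z] B) (Set.range y)) (1 ⊗ₜ c) (hx trivial)
    rwa [hsmul, map_one, Module.End.one_apply] at this

end TensorProduct

section
open Polynomial

/-- A finite free `𝕎 k`-module with commuting actions of a finite local Dedekind `ℤ_p`-algebra `A`
and an injective Frobenius-semilinear map is generated over `A ⊗ 𝕎 k` by as few elements as its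
rank permits. -/
theorem WittVector.exists_generators_of_frobenius_semilinear (p : ℕ) [Fact p.Prime] {k A E : Type*}
    [Field k] [IsAlgClosed k] [CharP k p] [CommRing A] [Algebra ℤ_[p] A] [Module.Finite ℤ_[p] A]
    [Module.Free ℤ_[p] A] [IsLocalRing A] [IsDedekindDomain A] [CharZero A]
    [AddCommGroup E] [Module (WittVector p k) E] [Module.Finite (WittVector p k) E]
    [Module.Free (WittVector p k) E] (φ : E →+ E) (hinj : Function.Injective φ)
    (hφ : ∀ (c : WittVector p k) (x : E), φ (c • x) = WittVector.frobeniusEquiv p k c • φ x)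
    (ρ : A →+* Module.End (WittVector p k) E)
    (hρ : ∀ z : ℤ_[p], ρ (algebraMap ℤ_[p] A z) =
      algebraMap ℤ_[p] (WittVector p k) z • (1 : Module.End (WittVector p k) E))
    (hρφ : ∀ (a : A) (x : E), φ (ρ a x) = ρ a (φ x)) :
    ∃ n : ℕ, Module.finrank (WittVector p k) E = Module.finrank ℤ_[p] A * n ∧ ∃ y : Fin n → E,
      ∀ N : Submodule (WittVector p k) E, (∀ a, ∀ x ∈ N, ρ a x ∈ N) → (∀ j, y j ∈ N) → N = ⊤ := by
  obtain ⟨f, hlen, hf, hcard⟩ := PadicInt.card_residueField_eq_pow p A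
  obtain ⟨ϖ, u, e, hm, hu, he, h⟩ := PadicInt.exists_uniformizer p A
  obtain ⟨H, ζ, a, hH, hdeg, hζ, ha, ha', hfix, hdist⟩ := PadicInt.exists_monic_root p A hcard
    (WittVector.constantCoeff.comp (algebraMap ℤ_[p] (WittVector p k)))
  obtain ⟨w, hw, hwf, hunit, hprod⟩ :=
    WittVector.exists_frobenius_cycle p k hf hH hdeg ha ha' hfix hdist
  have hB : maximalIdeal (WittVector p k) = Ideal.span {(p : WittVector p k)} :=
    (WittVector.irreducible p).maximalIdeal_eq
  have hp : (p : WittVector p k) ≠ 0 := WittVector.p_nonzero p k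
  have hroot : aeval (ρ ζ) (∏ i : Fin f, (X - C (w i))) = 0 := by
    rw [Fin.prod_univ_eq_prod_range (fun i => X - C (w i)) f, ← hprod]
    have : (aeval (ρ ζ)).toRingHom.comp (mapRingHom (algebraMap ℤ_[p] (WittVector p k))) =
        ρ.comp (aeval ζ : ℤ_[p][X] →ₐ[ℤ_[p]] A).toRingHom := by
      refine Polynomial.ringHom_ext (fun z => ?_) ?_
      · change aeval (ρ ζ) ((C z).map (algebraMap ℤ_[p] (WittVector p k))) = ρ (aeval ζ (C z))
        rw [map_C, aeval_C, aeval_C, hρ, Module.algebraMap_end_eq_smul_id, Module.End.one_eq_id]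
      · simp
    simpa [hζ] using RingHom.congr_fun this H
  have hrank (i j : Fin f) : Module.finrank (WittVector p k) ((ρ ζ).eigenspace (w i)) =
      Module.finrank (WittVector p k) ((ρ ζ).eigenspace (w j)) :=
    Nat.eq_of_le_succ_of_cycle
      (r := fun i => Module.finrank (WittVector p k) ((ρ ζ).eigenspace (w i)))
      (fun i => hw i ▸ Module.End.finrank_eigenspace_le_of_semilinear _ φ hinj hφ (hρφ ζ) (w i))
      (congrArg (fun c => Module.finrank (WittVector p k) ((ρ ζ).eigenspace c)) hwf) i.2.le j.2.le
  have : Nonempty (Fin f) := ⟨⟨0, Nat.pos_of_ne_zero hf⟩⟩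
  obtain ⟨n, hn, hy⟩ := Module.End.exists_generators_of_eigenspaces ρ hB hp he hu h
    (w := fun i : Fin f => w i)
    (fun i j hij => hunit i i.2 j j.2 fun h => hij (Fin.ext h)) hroot hrank
  rw [Fintype.card_fin, ← PadicInt.finrank_eq_mul p A hm hu he h hlen] at hn
  exact ⟨n, hn, hy⟩

end

end Helpers

/-- **Lemma B.1, Dieudonné-module incarnation.**  Let `k` be an algebraically
closed field of characteristic `p`, `W = 𝕎(k)`, `σ` the Frobenius of `W`, `F` a finite
extension of `ℚ_p` with ring of integers `O`.  Let `E` be a finite free `W`-module equipped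
with a `σ`-semilinear additive map `φ`, a `σ⁻¹`-semilinear additive map `V`, a ring
homomorphism `ι : O → End_W(E)` (compatible with the `ℤ_p`-structures, as needed for the
`O ⊗_{ℤ_p} W` action to be well defined) commuting with `φ` and `V`, and `m : ℕ` with
`φ∘V = V∘φ = p^m·id_E`.  Then `E`, with the `O ⊗_{ℤ_p} W`-module structure determined by `ι`
and the `W`-action, is a free `O ⊗_{ℤ_p} W`-module. -/
theorem dieudonne_free_over_tensor
    [Module.Finite (WittVector p k) E] [Module.Free (WittVector p k) E]
    (φ V : E →+ E)
    (hφ : ∀ (c : WittVector p k) (x : E),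
      φ (c • x) = WittVector.frobeniusEquiv p k c • φ x)
    (hV : ∀ (c : WittVector p k) (x : E),
      V (c • x) = (WittVector.frobeniusEquiv p k).symm c • V x)
    (ι : (integralClosure ℤ_[p] F) →+* Module.End (WittVector p k) E)
    (hι : ∀ z : ℤ_[p], ι (algebraMap ℤ_[p] (integralClosure ℤ_[p] F) z) =
      algebraMap ℤ_[p] (WittVector p k) z • (1 : Module.End (WittVector p k) E))
    (hιφ : ∀ (a : integralClosure ℤ_[p] F) (x : E), φ (ι a x) = ι a (φ x))
    (hιV : ∀ (a : integralClosure ℤ_[p] F) (x : E), V (ι a x) = ι a (V x))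
    (m : ℕ)
    (hφV : ∀ x : E, φ (V x) = (p : WittVector p k) ^ m • x)
    (hVφ : ∀ x : E, V (φ x) = (p : WittVector p k) ^ m • x) :
    letI := dieudonneTensorModule p k E F ι hι
    Module.Free ((integralClosure ℤ_[p] F) ⊗[ℤ_[p]] (WittVector p k)) E := by
  have : FaithfulSMul ℤ_[p] F := by
    rw [faithfulSMul_iff_algebraMap_injective, IsScalarTower.algebraMap_eq ℤ_[p] ℚ_[p] F]
    exact (algebraMap ℚ_[p] F).injective.comp (IsFractionRing.injective ℤ_[p] ℚ_[p])
  have : CharZero F := charZero_of_injective_algebraMap (algebraMap ℚ_[p] F).injective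
  have : CharZero (integralClosure ℤ_[p] F) :=
    charZero_of_injective_algebraMap
      (FaithfulSMul.algebraMap_injective ℤ_[p] (integralClosure ℤ_[p] F))
  have : Module.Finite ℤ_[p] (integralClosure ℤ_[p] F) :=
    IsIntegralClosure.finite ℤ_[p] ℚ_[p] F _
  have : Module.Free ℤ_[p] (integralClosure ℤ_[p] F) :=
    IsIntegralClosure.module_free ℤ_[p] ℚ_[p] F _
  have : IsDedekindDomain (integralClosure ℤ_[p] F) :=
    IsIntegralClosure.isDedekindDomain ℤ_[p] ℚ_[p] F _
  have : IsLocalRing (integralClosure ℤ_[p] F) := PadicInt.isLocalRing_of_finite p _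
  have hinj : Function.Injective φ := by
    rw [injective_iff_map_eq_zero]
    intro x hx
    have h := hVφ x
    rwa [hx, map_zero, eq_comm,
      smul_eq_zero_iff_right (pow_ne_zero m (WittVector.p_nonzero p k))] at h
  obtain ⟨n, hn, y, hy⟩ :=
    WittVector.exists_generators_of_frobenius_semilinear p φ hinj hφ ι hι hιφ
  let := dieudonneTensorModule p k E F ι hι
  exact Module.free_tensorProduct_of_generators (ρ := ι) (fun a b x => rfl) hι hn hy

end
end

section
/- The map Φ : 𝕎(J) → J^ℕ defined by Φ(x)_i = Σ_{j=0}^{i} δ_{i−j}(x_j) is well defined (each component lies in J) and is an isomorphism of abelian groups from the additive group 𝕎(J) onto the product group J^ℕ. (This is the first part of Lemma B.20 in the case O = ℤ_p, where the ramified Witt vectors W_O coincide with the p-typical Witt vectors; informally, Φ(x)_i = w_i(x)/p^i where w_i is the i-th ghost component.) -/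
open Finset

/-- Given a map `γ` (a divided-power operation on an ideal), the operations
`δ n x = p^{(1+p+⋯+p^{n−1})−n} · γ^{∘n}(x)`, with `δ 0 = id`. -/
noncomputable def pdDelta {R : Type*} [CommRing R] (p : ℕ) (γ : R → R) (n : ℕ) (x : R) : R :=
  (p : R) ^ ((∑ j ∈ Finset.range n, p ^ j) - n) * γ^[n] x

/-- The map `Φ : 𝕎(J) → J^ℕ`, `Φ(x)_i = Σ_{j=0}^{i} δ_{i−j}(x_j)` (informally `w_i(x)/p^i`). -/
noncomputable def pdGhost {R : Type*} [CommRing R] (p : ℕ) [Fact p.Prime] (γ : R → R)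
    (x : WittVector p R) (i : ℕ) : R :=
  ∑ j ∈ Finset.range (i + 1), pdDelta p γ (i - j) (x.coeff j)

/-- The product `∏ z_n ^ {k_n}` over the base-`p` digits `k_n` of `k`. -/
noncomputable def digitProd {T : Type*} [CommRing T] (p : ℕ) [hp : Fact p.Prime]
    (z : ℕ → T) (k : ℕ) : T :=
  if k = 0 then 1 else z 0 ^ (k % p) * digitProd p (fun n => z (n + 1)) (k / p)
termination_by k
decreasing_by exact Nat.div_lt_self (by omega) hp.out.one_lt

section DigitProd

variable {T : Type*} [CommRing T] (p : ℕ) [hp : Fact p.Prime]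

theorem digitProd_zero (z : ℕ → T) : digitProd p z 0 = 1 := by
  rw [digitProd, if_pos rfl]

theorem digitProd_rec (z : ℕ → T) (k : ℕ) :
    digitProd p z k = z 0 ^ (k % p) * digitProd p (fun n => z (n + 1)) (k / p) := by
  by_cases hk : k = 0
  · subst hk
    simp [digitProd_zero]
  · rw [digitProd, if_neg hk]

theorem digitProd_one (z : ℕ → T) : digitProd p z 1 = z 0 := by
  rw [digitProd_rec, Nat.mod_eq_of_lt hp.out.one_lt, Nat.div_eq_of_lt hp.out.one_lt,
    digitProd_zero, pow_one, mul_one]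

theorem digitProd_pow (n : ℕ) (z : ℕ → T) : digitProd p z (p ^ n) = z n := by
  induction n generalizing z with
  | zero => rw [pow_zero, digitProd_one]
  | succ n ih =>
    rw [digitProd_rec, pow_succ, Nat.mul_mod_left, Nat.mul_div_cancel _ hp.out.pos, ih, pow_zero,
      one_mul]

theorem map_digitProd {S : Type*} [CommRing S] (f : T →+* S) (z : ℕ → T) (k : ℕ) :
    f (digitProd p z k) = digitProd p (fun n => f (z n)) k := by
  induction k using Nat.strong_induction_on generalizing z with
  | _ k ih =>
    by_cases hk : k = 0
    · subst hk
      simp [digitProd_zero]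
    · rw [digitProd_rec, map_mul, map_pow, ih _ (Nat.div_lt_self (by omega) hp.out.one_lt),
        ← digitProd_rec p (fun n => f (z n))]

theorem exists_digitProd_mul (z : ℕ → T) (hz : ∀ n, z n ^ p = p * z (n + 1)) (k l : ℕ) :
    ∃ N : ℕ, digitProd p z k * digitProd p z l = N * digitProd p z (k + l) := by
  induction hs : k + l using Nat.strong_induction_on generalizing z k l with
  | _ s ih =>
    subst hs
    have hp2 := hp.out.two_le
    have hppos := hp.out.pos
    by_cases h0 : k + l = 0
    · obtain ⟨rfl, rfl⟩ : k = 0 ∧ l = 0 := by omega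
      exact ⟨1, by simp [digitProd_zero]⟩
    have hk := Nat.mod_add_div k p
    have hl := Nat.mod_add_div l p
    have hkp := Nat.mod_lt k hppos
    have hlp := Nat.mod_lt l hppos
    have hz' : ∀ n, (fun n => z (n + 1)) n ^ p = p * (fun n => z (n + 1)) (n + 1) :=
      fun n => hz (n + 1)
    have hpkl : 2 * (k / p + l / p) ≤ p * (k / p) + p * (l / p) := by
      rw [← mul_add]
      exact Nat.mul_le_mul_right _ hp2
    have hk0 := Nat.zero_le (k / p)
    have hl0 := Nat.zero_le (l / p)
    by_cases hc : k % p + l % p < p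
    · obtain ⟨N, hN⟩ := ih (k / p + l / p) (by omega) _ hz' _ _ rfl
      have e : k + l = (k % p + l % p) + p * (k / p + l / p) := by rw [mul_add]; omega
      have e1 : (k + l) % p = k % p + l % p := by
        rw [e, Nat.add_mul_mod_self_left, Nat.mod_eq_of_lt hc]
      have e2 : (k + l) / p = k / p + l / p := by
        rw [e, Nat.add_mul_div_left _ _ hppos, Nat.div_eq_of_lt hc, zero_add]
      refine ⟨N, ?_⟩
      rw [digitProd_rec p z k, digitProd_rec p z l, digitProd_rec p z (k + l), e1, e2, pow_add]
      linear_combination z 0 ^ (k % p) * z 0 ^ (l % p) * hN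
    · obtain ⟨c, hc'⟩ := Nat.exists_eq_add_of_le (not_lt.mp hc)
      obtain ⟨M, hM⟩ := ih (1 + k / p) (by omega) _ hz' _ _ rfl
      obtain ⟨N, hN⟩ := ih (1 + k / p + l / p) (by omega) _ hz' _ _ rfl
      have e : k + l = c + p * (1 + k / p + l / p) := by rw [mul_add, mul_add]; omega
      have hcp : c < p := by omega
      have e1 : (k + l) % p = c := by
        rw [e, Nat.add_mul_mod_self_left, Nat.mod_eq_of_lt hcp]
      have e2 : (k + l) / p = 1 + k / p + l / p := by
        rw [e, Nat.add_mul_div_left _ _ hppos, Nat.div_eq_of_lt hcp, zero_add]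
      refine ⟨p * M * N, ?_⟩
      rw [digitProd_rec p z k, digitProd_rec p z l, digitProd_rec p z (k + l), e1, e2]
      rw [digitProd_one] at hM
      have h1 : z 0 ^ (k % p) * z 0 ^ (l % p) = p * z 1 * z 0 ^ c := by
        rw [← pow_add, hc', pow_add, hz 0]
      simp only [zero_add] at hM
      push_cast
      linear_combination digitProd p (fun n => z (n + 1)) (k / p) *
        digitProd p (fun n => z (n + 1)) (l / p) * h1 +
        p * z 0 ^ c * digitProd p (fun n => z (n + 1)) (l / p) * hM + p * M * z 0 ^ c * hN

theorem exists_digitProd_eq_smul_pow {K : Type*} [Field K] [Algebra K T] (b : T) (z : ℕ → T)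
    (hz : ∀ n, ∃ c : K, c ≠ 0 ∧ z n = c • b ^ p ^ n) (k : ℕ) :
    ∃ c : K, c ≠ 0 ∧ digitProd p z k = c • b ^ k := by
  induction k using Nat.strong_induction_on generalizing z b with
  | _ k ih =>
    by_cases hk : k = 0
    · subst hk
      exact ⟨1, one_ne_zero, by simp [digitProd_zero]⟩
    · obtain ⟨c, hc, hc'⟩ := ih _ (Nat.div_lt_self (by omega) hp.out.one_lt) (b ^ p)
        (fun n => z (n + 1)) (fun n => by
          obtain ⟨c, hc, h⟩ := hz (n + 1)
          exact ⟨c, hc, by rw [h, ← pow_mul, ← pow_succ']⟩)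
      obtain ⟨d, hd, hd'⟩ := hz 0
      refine ⟨d ^ (k % p) * c, mul_ne_zero (pow_ne_zero _ hd) hc, ?_⟩
      rw [digitProd_rec, hc', hd', smul_pow, smul_mul_smul_comm, pow_zero, pow_one, ← pow_mul,
        ← pow_add, Nat.mod_add_div]

variable {V : Type*}

/-- The product of the `digitProd`s of the sequences `z v` for the exponents `m v`. -/
noncomputable def digitMonomial (z : V → ℕ → T) (m : V →₀ ℕ) : T :=
  m.prod fun v k => digitProd p (z v) k

theorem exists_digitMonomial_mul (z : V → ℕ → T) (hz : ∀ v n, z v n ^ p = p * z v (n + 1))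
    (m m' : V →₀ ℕ) :
    ∃ N : ℕ, digitMonomial p z m * digitMonomial p z m' = N * digitMonomial p z (m + m') := by
  classical
  choose N hN using fun v => exists_digitProd_mul p (z v) (hz v) (m v) (m' v)
  refine ⟨∏ v ∈ m.support ∪ m'.support, N v, ?_⟩
  unfold digitMonomial
  rw [Finsupp.prod_of_support_subset m Finset.subset_union_left _
      (fun _ _ => digitProd_zero p _),
    Finsupp.prod_of_support_subset m' Finset.subset_union_right _
      (fun _ _ => digitProd_zero p _),
    Finsupp.prod_of_support_subset (m + m') Finsupp.support_add _
      (fun _ _ => digitProd_zero p _), ← Finset.prod_mul_distrib, Nat.cast_prod,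
    ← Finset.prod_mul_distrib]
  exact Finset.prod_congr rfl fun v _ => hN v

/-- The subring additively generated by the digit monomials in `z`. -/
noncomputable def digitSubring (z : V → ℕ → T) (hz : ∀ v n, z v n ^ p = p * z v (n + 1)) :
    Subring T where
  __ := AddSubgroup.closure (Set.range (digitMonomial p z))
  one_mem' := AddSubgroup.subset_closure ⟨0, by simp [digitMonomial]⟩
  mul_mem' := by
    intro a b ha hb
    change a ∈ AddSubgroup.closure (Set.range (digitMonomial p z)) at ha
    change b ∈ AddSubgroup.closure (Set.range (digitMonomial p z)) at hb
    change a * b ∈ AddSubgroup.closure (Set.range (digitMonomial p z))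
    induction ha, hb using AddSubgroup.closure_induction₂ with
    | mem a b ha hb =>
      obtain ⟨m, rfl⟩ := ha
      obtain ⟨m', rfl⟩ := hb
      obtain ⟨N, hN⟩ := exists_digitMonomial_mul p z hz m m'
      rw [hN, ← nsmul_eq_mul]
      exact AddSubgroup.nsmul_mem _ (AddSubgroup.subset_closure (Set.mem_range_self _)) _
    | zero_left b hb => rw [zero_mul]; exact zero_mem _
    | zero_right b hb => rw [mul_zero]; exact zero_mem _
    | add_left a b c _ _ _ h1 h2 => rw [add_mul]; exact add_mem h1 h2
    | add_right a b c _ _ _ h1 h2 => rw [mul_add]; exact add_mem h1 h2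
    | neg_left a b _ _ h => rw [neg_mul]; exact neg_mem h
    | neg_right a b _ _ h => rw [mul_neg]; exact neg_mem h

theorem mem_digitSubring (z : V → ℕ → T) (hz : ∀ v n, z v n ^ p = p * z v (n + 1)) (v : V)
    (n : ℕ) : z v n ∈ digitSubring p z hz := by
  refine AddSubgroup.subset_closure ⟨Finsupp.single v (p ^ n), ?_⟩
  rw [digitMonomial, Finsupp.prod_single_index (digitProd_zero p _), digitProd_pow]

theorem eq_zero_of_mem_digitSubring (z : V → ℕ → T) (hz : ∀ v n, z v n ^ p = p * z v (n + 1))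
    (f : T →+* MvPolynomial V ℚ)
    (hf : ∀ v n, ∃ c : ℚ, c ≠ 0 ∧ f (z v n) = c • MvPolynomial.X v ^ p ^ n)
    {t : T} (ht : t ∈ digitSubring p z hz) (h : f t = 0) : t = 0 := by
  classical
  have hmon : ∀ m, ∃ c : ℚ, c ≠ 0 ∧ f (digitMonomial p z m) = MvPolynomial.monomial m c := by
    intro m
    choose c hc hc' using fun v =>
      exists_digitProd_eq_smul_pow p (MvPolynomial.X v) (fun n => f (z v n)) (hf v) (m v)
    refine ⟨∏ v ∈ m.support, c v, Finset.prod_ne_zero_iff.mpr fun v _ => hc v, ?_⟩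
    rw [digitMonomial, Finsupp.prod, map_prod, MvPolynomial.monomial_eq, Finsupp.prod, map_prod,
      ← Finset.prod_mul_distrib]
    refine Finset.prod_congr rfl fun v _ => ?_
    rw [map_digitProd, hc', MvPolynomial.smul_eq_C_mul]
  choose c hc hc' using hmon
  replace ht : t ∈ Submodule.span ℤ (Set.range (digitMonomial p z)) := by
    rw [← Submodule.mem_toAddSubgroup, Submodule.span_int_eq_addSubgroupClosure]
    exact ht
  obtain ⟨a, rfl⟩ := Finsupp.mem_span_range_iff_exists_finsupp.mp ht
  have ha : a = 0 := by
    ext m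
    have := congrArg (MvPolynomial.coeff m) h
    rw [Finsupp.sum, map_sum, MvPolynomial.coeff_sum, Finset.sum_eq_single m] at this
    · rw [map_zsmul, hc', ← Int.cast_smul_eq_zsmul ℚ, MvPolynomial.coeff_smul,
        MvPolynomial.coeff_monomial, if_pos rfl, MvPolynomial.coeff_zero, smul_eq_mul] at this
      simpa [hc m] using this
    · intro b _ hb
      rw [map_zsmul, hc', ← Int.cast_smul_eq_zsmul ℚ, MvPolynomial.coeff_smul,
        MvPolynomial.coeff_monomial, if_neg hb, smul_zero]
    · intro hm
      simp [Finsupp.notMem_support_iff.mp hm]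
  simp [ha]

end DigitProd

theorem pdDelta_mem {R : Type*} [CommRing R] (p : ℕ) {J : Ideal R} {γ : R → R} (hmaps : ∀ x ∈ J, γ x ∈ J) (n : ℕ) {x : R}
    (hx : x ∈ J) : pdDelta p γ n x ∈ J := by
  refine J.mul_mem_left _ ?_
  induction n with
  | zero => exact hx
  | succ n ih => rw [Function.iterate_succ_apply']; exact hmaps _ ih

section Ghost

variable {R : Type*} [CommRing R] (p : ℕ) [hp : Fact p.Prime]

theorem pow_mul_pdDelta {γ : R → R} (hpow : ∀ x, (p : R) * γ x = x ^ p) (n : ℕ) (x : R) :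
    (p : R) ^ n * pdDelta p γ n x = x ^ p ^ n := by
  have hle : n ≤ ∑ j ∈ Finset.range n, p ^ j := by
    simpa using Finset.card_nsmul_le_sum (Finset.range n) (fun j => p ^ j) 1
      (fun j _ => Nat.one_le_pow _ _ hp.out.pos)
  rw [pdDelta, ← mul_assoc, ← pow_add, Nat.add_sub_cancel' hle]
  clear hle
  induction n with
  | zero => simp
  | succ n ih =>
    rw [Function.iterate_succ_apply', Finset.sum_range_succ']
    rw [pow_add, pow_zero, pow_one, mul_assoc, hpow, pow_succ p n, pow_mul x, ← ih, mul_pow,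
      ← pow_mul, Finset.sum_mul]
    simp only [pow_succ]

theorem pow_mul_pdGhost {γ : R → R} (hpow : ∀ x, (p : R) * γ x = x ^ p) (x : WittVector p R)
    (i : ℕ) : (p : R) ^ i * pdGhost p γ x i = WittVector.ghostComponent i x := by
  rw [WittVector.ghostComponent_apply, wittPolynomial_eq_sum_C_mul_X_pow, map_sum, pdGhost,
    Finset.mul_sum]
  refine Finset.sum_congr rfl fun j hj => ?_
  have hj' : i = j + (i - j) := by have := Finset.mem_range.mp hj; omega
  conv_lhs => rw [hj', pow_add, Nat.add_sub_cancel_left, mul_assoc, pow_mul_pdDelta p hpow]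
  simp

theorem map_pdGhost {S : Type*} [CommRing S] (f : R →+* S) {γ : R → R} {γ' : S → S}
    (h : ∀ x, f (γ x) = γ' (f x)) (x : WittVector p R) (i : ℕ) :
    f (pdGhost p γ x i) = pdGhost p γ' (WittVector.map f x) i := by
  simp only [pdGhost, pdDelta, map_sum, map_mul, map_pow, map_natCast, WittVector.map_coeff]
  refine Finset.sum_congr rfl fun j _ => ?_
  rw [(show Function.Semiconj f γ γ' from h).iterate_right]

theorem WittVector.coeff_add_mem {J : Ideal R} {x y : WittVector p R}
    (hx : ∀ i, x.coeff i ∈ J) (hy : ∀ i, y.coeff i ∈ J) (i : ℕ) : (x + y).coeff i ∈ J := by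
  have key : ∀ z : WittVector p R,
      (∀ i, z.coeff i ∈ J) ↔ WittVector.map (Ideal.Quotient.mk J) z = 0 := by
    intro z
    simp [WittVector.ext_iff, WittVector.map_coeff, Ideal.Quotient.eq_zero_iff_mem]
  exact (key _).mpr (by rw [map_add, (key x).mp hx, (key y).mp hy, add_zero]) i

theorem pdGhost_eq_add_sum (γ : R → R) (x : WittVector p R) (i : ℕ) :
    pdGhost p γ x i = (∑ j ∈ Finset.range i, pdDelta p γ (i - j) (x.coeff j)) + x.coeff i := by
  rw [pdGhost, Finset.sum_range_succ]
  simp [pdDelta]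

/-- The coefficients of the Witt vector whose image under `pdGhost` is `g`. -/
noncomputable def pdGhostInv (γ : R → R) (g : ℕ → R) (i : ℕ) : R :=
  g i - ∑ j : Fin i, pdDelta p γ (i - j) (pdGhostInv γ g j)

/-- The product of the operation `γ` on `R` with the operation `b ↦ p⁻¹ b ^ p` on the polynomial
ring over `ℚ` in the variables `V`. -/
noncomputable def pdProd (V : Type*) (γ : R → R) (t : R × MvPolynomial V ℚ) :
    R × MvPolynomial V ℚ :=
  (γ t.1, (p : ℚ)⁻¹ • t.2 ^ p)

theorem prime_mul_smul_pow {V : Type*} (b : MvPolynomial V ℚ) :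
    (p : MvPolynomial V ℚ) * ((p : ℚ)⁻¹ • b ^ p) = b ^ p := by
  have : (p : ℚ) ≠ 0 := Nat.cast_ne_zero.mpr hp.out.ne_zero
  rw [← nsmul_eq_mul, ← Nat.cast_smul_eq_nsmul ℚ, smul_smul, mul_inv_cancel₀ this, one_smul]

theorem inv_smul_add_pow {V : Type*} (a b : MvPolynomial V ℚ) :
    (p : ℚ)⁻¹ • (a + b) ^ p = (p : ℚ)⁻¹ • a ^ p + (p : ℚ)⁻¹ • b ^ p +
      ∑ i ∈ Finset.Ioo 0 p, ((p.choose i / p : ℕ) : MvPolynomial V ℚ) * a ^ i * b ^ (p - i) := by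
  have hp0 : (p : MvPolynomial V ℚ) ≠ 0 := Nat.cast_ne_zero.mpr hp.out.ne_zero
  apply mul_left_cancel₀ hp0
  rw [mul_add, mul_add, prime_mul_smul_pow, prime_mul_smul_pow, prime_mul_smul_pow, add_pow,
    Finset.sum_range_succ, Finset.range_eq_Ico, ← Finset.Ioo_insert_left hp.out.pos,
    Finset.sum_insert Finset.left_notMem_Ioo]
  have hsum : ∑ i ∈ Finset.Ioo 0 p, a ^ i * b ^ (p - i) * (p.choose i : MvPolynomial V ℚ) =
      p * ∑ i ∈ Finset.Ioo 0 p,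
        ((p.choose i / p : ℕ) : MvPolynomial V ℚ) * a ^ i * b ^ (p - i) := by
    rw [Finset.mul_sum]
    refine Finset.sum_congr rfl fun i hi => ?_
    obtain ⟨hi0, hip⟩ := Finset.mem_Ioo.mp hi
    have hdvd := hp.out.dvd_choose_self hi0.ne' hip
    conv_lhs => rw [← Nat.mul_div_cancel' hdvd, Nat.cast_mul]
    ring
  rw [hsum, pow_zero, Nat.sub_zero, Nat.sub_self, Nat.choose_zero_right, Nat.choose_self]
  push_cast
  ring

theorem pdGhost_add {J : Ideal R} {γ : R → R}
    (hmaps : ∀ x ∈ J, γ x ∈ J)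
    (hsmul : ∀ (a : R), ∀ x ∈ J, γ (a * x) = a ^ p * γ x)
    (hpow : ∀ x ∈ J, (p : R) * γ x = x ^ p)
    (hadd : ∀ x ∈ J, ∀ y ∈ J, γ (x + y) = γ x + γ y +
      ∑ i ∈ Finset.Ioo 0 p, ((p.choose i / p : ℕ) : R) * x ^ i * y ^ (p - i))
    {x y : WittVector p R} (hx : ∀ i, x.coeff i ∈ J) (hy : ∀ i, y.coeff i ∈ J) (i : ℕ) :
    pdGhost p γ (x + y) i = pdGhost p γ x i + pdGhost p γ y i := by
  let V := ℕ ⊕ ℕ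
  let G := pdProd p V γ
  let c : V → R := Sum.elim x.coeff y.coeff
  have hc : ∀ v, c v ∈ J := by rintro (n | n); exacts [hx n, hy n]
  let z : V → ℕ → R × MvPolynomial V ℚ := fun v n => G^[n] (c v, MvPolynomial.X v)
  have hzs : ∀ v n, z v (n + 1) = G (z v n) := fun v n => Function.iterate_succ_apply' _ _ _
  have hzJ : ∀ v n, (z v n).1 ∈ J := by
    intro v n
    induction n with
    | zero => exact hc v
    | succ n ih => rw [hzs]; exact hmaps _ ih
  have hz : ∀ v n, z v n ^ p = p * z v (n + 1) := by
    intro v n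
    rw [hzs]
    exact Prod.ext (hpow _ (hzJ v n)).symm (prime_mul_smul_pow p _).symm
  have hz2 : ∀ v n, ∃ c : ℚ, c ≠ 0 ∧ (z v n).2 = c • MvPolynomial.X v ^ p ^ n := by
    intro v n
    induction n with
    | zero => exact ⟨1, one_ne_zero, by simp [z]⟩
    | succ n ih =>
      obtain ⟨c, hc, h⟩ := ih
      refine ⟨(p : ℚ)⁻¹ * c ^ p, mul_ne_zero
        (inv_ne_zero (Nat.cast_ne_zero.mpr hp.out.ne_zero)) (pow_ne_zero _ hc), ?_⟩
      rw [hzs]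
      change (p : ℚ)⁻¹ • (z v n).2 ^ p = _
      rw [h, smul_pow, smul_smul, ← pow_mul, ← pow_succ]
  let E := digitSubring p z hz
  let I : Ideal E := Ideal.span (Set.range fun vn : V × ℕ =>
    (⟨z vn.1 vn.2, mem_digitSubring p z hz _ _⟩ : E))
  have hI : ∀ e ∈ I, (e : R × MvPolynomial V ℚ).1 ∈ J ∧
      ∃ e' ∈ I, (e' : R × MvPolynomial V ℚ) = G e := by
    intro e he
    induction he using Submodule.span_induction with
    | mem e he =>
      obtain ⟨⟨v, n⟩, rfl⟩ := he
      exact ⟨hzJ v n, _, Ideal.subset_span ⟨(v, n + 1), rfl⟩, hzs v n⟩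
    | zero =>
      refine ⟨J.zero_mem, 0, I.zero_mem, ?_⟩
      have h0 : γ 0 = 0 := by
        simpa [hp.out.ne_zero] using hsmul 0 0 J.zero_mem
      exact Prod.ext h0.symm (by simp [G, pdProd, hp.out.ne_zero])
    | add a b ha hb iha ihb =>
      obtain ⟨haJ, a', ha', hGa⟩ := iha
      obtain ⟨hbJ, b', hb', hGb⟩ := ihb
      refine ⟨J.add_mem haJ hbJ, a' + b' +
        ∑ i ∈ Finset.Ioo 0 p, ((p.choose i / p : ℕ) : E) * a ^ i * b ^ (p - i),
        I.add_mem (I.add_mem ha' hb') (I.sum_mem fun i hi => ?_), ?_⟩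
      · exact I.mul_mem_right _ (I.mul_mem_left _
          (I.pow_mem_of_mem ha _ (Finset.mem_Ioo.mp hi).1))
      · push_cast
        rw [hGa, hGb]
        refine Prod.ext ?_ ?_
        · simpa [G, pdProd, Prod.fst_sum] using (hadd _ haJ _ hbJ).symm
        · simpa [G, pdProd, Prod.snd_sum] using (inv_smul_add_pow p _ _).symm
    | smul s e he ih =>
      obtain ⟨heJ, e', he', hG⟩ := ih
      refine ⟨J.mul_mem_left _ heJ, s ^ p * e', I.mul_mem_left _ he', ?_⟩
      push_cast
      rw [hG]
      refine Prod.ext ?_ ?_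
      · exact (hsmul _ _ heJ).symm
      · simp [G, pdProd, mul_pow]
  have hGhost : ∀ w : WittVector p E, (∀ j, w.coeff j ∈ I) →
      pdGhost p G (WittVector.map E.subtype w) i ∈ E := by
    intro w hw
    refine E.sum_mem fun j _ => E.mul_mem (E.pow_mem (natCast_mem E p) _) ?_
    generalize i - j = n
    suffices ∃ e ∈ I, (e : R × MvPolynomial V ℚ) = G^[n] (w.coeff j) by
      obtain ⟨e, -, he⟩ := this
      rw [WittVector.map_coeff, Subring.subtype_apply, ← he]
      exact e.2
    induction n with
    | zero => exact ⟨_, hw j, rfl⟩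
    | succ n ih =>
      obtain ⟨e, he, h⟩ := ih
      rw [Function.iterate_succ_apply', ← h]
      exact (hI e he).2
  have hz0 : ∀ v, z v 0 ∈ E := fun v => mem_digitSubring p z hz v 0
  have hz0I : ∀ v, (⟨z v 0, hz0 v⟩ : E) ∈ I := fun v => Ideal.subset_span ⟨(v, 0), rfl⟩
  let X : WittVector p E := WittVector.mk p fun n => ⟨z (.inl n) 0, hz0 _⟩
  let Y : WittVector p E := WittVector.mk p fun n => ⟨z (.inr n) 0, hz0 _⟩
  have hXI : ∀ j, X.coeff j ∈ I := fun j => hz0I _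
  have hYI : ∀ j, Y.coeff j ∈ I := fun j => hz0I _
  let fst := RingHom.fst R (MvPolynomial V ℚ)
  let snd := RingHom.snd R (MvPolynomial V ℚ)
  have hX : WittVector.map fst (WittVector.map E.subtype X) = x := by
    ext n
    rfl
  have hY : WittVector.map fst (WittVector.map E.subtype Y) = y := by
    ext n
    rfl
  have hfst := map_pdGhost p fst (γ := G) (γ' := γ) (fun _ => rfl)
  have hsnd := map_pdGhost p snd (γ := G) (γ' := fun b => (p : ℚ)⁻¹ • b ^ p) (fun _ => rfl)
  have hzero : pdGhost p G (WittVector.map E.subtype (X + Y)) i -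
      (pdGhost p G (WittVector.map E.subtype X) i +
        pdGhost p G (WittVector.map E.subtype Y) i) = 0 := by
    refine eq_zero_of_mem_digitSubring p z hz snd hz2
      (E.sub_mem (hGhost _ (WittVector.coeff_add_mem p hXI hYI))
        (E.add_mem (hGhost _ hXI) (hGhost _ hYI))) ?_
    have hpi : (p : MvPolynomial V ℚ) ^ i ≠ 0 :=
      pow_ne_zero _ (Nat.cast_ne_zero.mpr hp.out.ne_zero)
    apply mul_left_cancel₀ hpi
    simp only [map_sub, map_add, hsnd, mul_zero, mul_sub, mul_add,
      pow_mul_pdGhost p (prime_mul_smul_pow p), sub_self]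
  have := congrArg fst hzero
  simp only [map_sub, map_add, hfst, hX, hY, map_zero] at this
  exact sub_eq_zero.mp this

end Ghost

/-- **Lemma B.20, first part, case `O = ℤ_p`.**  Let `J` be an ideal of a
commutative ring `R` equipped with a `ℤ_p`-divided-power structure `γ`.  Then the map
`Φ : 𝕎(J) → J^ℕ`, `Φ(x)_i = Σ_{j=0}^{i} δ_{i−j}(x_j)`, is well defined (each component lies
in `J`) and is an isomorphism of abelian groups from the additive group `𝕎(J)` (the Witt
vectors all of whose coefficients lie in `J`) onto the product group `J^ℕ`:
it is additive, injective, and surjective onto sequences with values in `J`. -/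
theorem wittVector_pd_ghost_equiv {R : Type*} [CommRing R] (p : ℕ) [Fact p.Prime]
    (J : Ideal R) (γ : R → R)
    (hmaps : ∀ x ∈ J, γ x ∈ J)
    (hsmul : ∀ (a : R), ∀ x ∈ J, γ (a * x) = a ^ p * γ x)
    (hpow : ∀ x ∈ J, (p : R) * γ x = x ^ p)
    (hadd : ∀ x ∈ J, ∀ y ∈ J, γ (x + y) = γ x + γ y +
      ∑ i ∈ Finset.Ioo 0 p, ((p.choose i / p : ℕ) : R) * x ^ i * y ^ (p - i)) :
    (∀ x : WittVector p R, (∀ i, x.coeff i ∈ J) → ∀ i, pdGhost p γ x i ∈ J) ∧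
    (∀ x y : WittVector p R, (∀ i, x.coeff i ∈ J) → (∀ i, y.coeff i ∈ J) →
      ∀ i, pdGhost p γ (x + y) i = pdGhost p γ x i + pdGhost p γ y i) ∧
    (∀ x y : WittVector p R, (∀ i, x.coeff i ∈ J) → (∀ i, y.coeff i ∈ J) →
      (∀ i, pdGhost p γ x i = pdGhost p γ y i) → x = y) ∧
    (∀ g : ℕ → R, (∀ i, g i ∈ J) →
      ∃ x : WittVector p R, (∀ i, x.coeff i ∈ J) ∧ ∀ i, pdGhost p γ x i = g i) := by
  refine ⟨fun x hx i => J.sum_mem fun j _ => pdDelta_mem p hmaps _ (hx j),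
    fun x y hx hy i => pdGhost_add p hmaps hsmul hpow hadd hx hy i, fun x y _ _ h => ?_,
    fun g hg => ?_⟩
  · ext i
    induction i using Nat.strong_induction_on with
    | _ i ih =>
      have hi := h i
      rw [pdGhost_eq_add_sum, pdGhost_eq_add_sum, Finset.sum_congr rfl fun j hj => by
        rw [ih j (Finset.mem_range.mp hj)]] at hi
      exact add_left_cancel hi
  · refine ⟨WittVector.mk p (pdGhostInv p γ g), fun i => ?_, fun i => ?_⟩
    · change pdGhostInv p γ g i ∈ J
      induction i using Nat.strong_induction_on with
      | _ i ih =>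
        rw [pdGhostInv]
        exact J.sub_mem (hg i) (J.sum_mem fun j _ => pdDelta_mem p hmaps _ (ih j j.2))
    · rw [pdGhost_eq_add_sum]
      change _ + pdGhostInv p γ g i = g i
      rw [pdGhostInv, Fin.sum_univ_eq_sum_range
        (fun j => pdDelta p γ (i - j) (pdGhostInv p γ g j)) i]
      exact add_sub_cancel _ _
end
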